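/- Let d≥2 and let β_1,…,β_d≥0. Let X_1,…,X_n be i.i.d. random points in the cube [−1,1]^d whose coordinates are independent, the i-th coordinate having density c_{β_i}(1−t^2)^{β_i} on [−1,1], and let P_n^β=conv{X_1,…,X_n}. Then E f_{d−1}(P_n^β) ≍ (ln n)^{d−1}, with implied constants depending only on d and (β_1,…,β_d); in particular the asymptotic order is independent of the choice of β_1,…,β_d≥0. -/

import Mathlib

open MeasureTheory Filter

noncomputable section

/-- Normalizing constant `c_β` of the one-dimensional beta density on `[−1,1]`. -/
def betaConst1 (β : ℝ) : ℝ :=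
  Real.Gamma (3 / 2 + β) / (Real.pi ^ ((1 : ℝ) / 2) * Real.Gamma (β + 1))

/-- The one-dimensional beta probability distribution on `[−1,1]` with parameter `β`. -/
def betaMeasure1 (β : ℝ) : Measure ℝ :=
  volume.withDensity fun t =>
    ENNReal.ofReal (if |t| ≤ 1 then betaConst1 β * (1 - t ^ 2) ^ β else 0)

/-- The number of `j`-dimensional faces of a convex body `K`: faces are the nonempty
convex extreme subsets of `K`, and the dimension of a face is the dimension of its
affine hull. -/
def faceCount {E : Type*} [AddCommGroup E] [Module ℝ E] (K : Set E) (j : ℕ) : ℕ :=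
  Nat.card {F : Set E // F.Nonempty ∧ Convex ℝ F ∧ IsExtreme ℝ K F ∧
    Module.finrank ℝ (vectorSpan ℝ F) = j}

/-- Expected number of facets of the convex hull of `n` i.i.d. random points in the
cube `[−1,1]^d` whose coordinates are independent beta variables with parameters
`β_1, …, β_d`. -/
def expectedFacetsCube (d : ℕ) (β : Fin d → ℝ) (n : ℕ) : ℝ :=
  ∫ x : Fin n → (Fin d → ℝ),
    (faceCount (convexHull ℝ (Set.range x)) (d - 1) : ℝ)
    ∂(Measure.pi fun _ : Fin n => Measure.pi fun i => betaMeasure1 (β i))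

section Facets

variable {E : Type*} [NormedAddCommGroup E] [NormedSpace ℝ E] [FiniteDimensional ℝ E]
  {ι : Type*} [Fintype ι] {d : ℕ}

omit [FiniteDimensional ℝ E] in
/-- An extreme convex subset of a polytope is spanned by the generators it contains. -/
lemma IsExtreme.subset_convexHull_image {x : ι → E} {F : Set E}
    (h : IsExtreme ℝ (convexHull ℝ (Set.range x)) F) :
    F ⊆ convexHull ℝ (x '' {i | x i ∈ F}) := by
  classical
  intro p hp
  obtain ⟨w, z, hw0, hw1, hz, hp'⟩ : ∃ (w : ι → ℝ) (z : ι → E), (∀ i, 0 ≤ w i) ∧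
      ∑ i, w i = 1 ∧ (∀ i, z i = x i) ∧ ∑ i, w i • z i = p := by
    have := h.subset hp
    rw [convexHull_range_eq_exists_affineCombination] at this
    obtain ⟨s, w, hw0, hw1, hp'⟩ := this
    refine ⟨fun i => if i ∈ s then w i else 0, x, ?_, ?_, fun _ => rfl, ?_⟩
    · intro i; dsimp; split_ifs with hi
      · exact hw0 i hi
      · exact le_rfl
    · simpa using hw1
    · rw [← hp', s.affineCombination_eq_linear_combination _ _ hw1]
      simp [ite_smul]
  obtain rfl : z = x := funext hz
  have key : ∀ i, 0 < w i → z i ∈ F := by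
    intro i hi
    have hle : w i ≤ 1 := hw1 ▸ Finset.single_le_sum (fun j _ => hw0 j) (Finset.mem_univ i)
    have hsum : w i + ∑ j ∈ Finset.univ.erase i, w j = 1 := by
      rw [Finset.add_sum_erase _ _ (Finset.mem_univ i), hw1]
    have hsum' : w i • z i + ∑ j ∈ Finset.univ.erase i, w j • z j = p := by
      rw [Finset.add_sum_erase _ (fun j => w j • z j) (Finset.mem_univ i), hp']
    rcases hle.lt_or_eq with hlt | heq
    · have hpos : 0 < ∑ j ∈ Finset.univ.erase i, w j := by linarith
      refine h.left_mem_of_mem_openSegment (subset_convexHull ℝ _ ⟨i, rfl⟩)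
        (y := (Finset.univ.erase i).centerMass w z) ?_ hp ?_
      · exact Finset.centerMass_mem_convexHull _ (fun j _ => hw0 j) hpos (fun j _ => ⟨j, rfl⟩)
      · refine ⟨w i, _, hi, hpos, hsum, ?_⟩
        rw [Finset.centerMass, smul_smul, mul_inv_cancel₀ hpos.ne', one_smul, hsum']
    · have h0 : ∑ j ∈ Finset.univ.erase i, w j = 0 := by linarith
      have h1 : ∀ j ∈ Finset.univ.erase i, w j = 0 :=
        (Finset.sum_eq_zero_iff_of_nonneg (fun j _ => hw0 j)).1 h0
      rw [Finset.sum_eq_zero (fun j hj => by rw [h1 j hj, zero_smul]), heq, one_smul,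
        add_zero] at hsum'
      exact hsum' ▸ hp
  have : p = (Finset.univ.filter fun i => 0 < w i).centerMass w z := by
    have hf : ∑ i with 0 < w i, w i = 1 := by
      rw [← hw1]
      exact Finset.sum_filter_of_ne fun i _ hi => (hw0 i).lt_of_ne' hi
    rw [Finset.centerMass, hf, inv_one, one_smul, ← hp']
    exact (Finset.sum_filter_of_ne fun i _ hi =>
      (hw0 i).lt_of_ne' fun h0 => hi (by rw [h0, zero_smul])).symm
  rw [this]
  refine Finset.centerMass_mem_convexHull _ (fun i _ => hw0 i) ?_ fun i hi => ?_
  · have hf : ∑ i with 0 < w i, w i = 1 := by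
      rw [← hw1]
      exact Finset.sum_filter_of_ne fun i _ hi => (hw0 i).lt_of_ne' hi
    rw [hf]; exact one_pos
  · exact ⟨i, key i (by simpa using hi), rfl⟩

/-- Some nonzero linear functional attains its maximum over the family `x` at every index of
`S`. -/
def Supported (x : ι → E) (S : Set ι) : Prop :=
  ∃ f : Module.Dual ℝ E, f ≠ 0 ∧ ∀ i ∈ S, ∀ j, f (x j) ≤ f (x i)

/-- The affinely independent `d`-tuples of members of `x` which lie on a common supporting
hyperplane. -/
def IsFacetTuple (x : ι → E) (τ : Fin d → ι) : Prop :=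
  AffineIndependent ℝ (x ∘ τ) ∧ Supported x (Set.range τ)

/-- The face spanned by a tuple. -/
def tupleFace (x : ι → E) (τ : Fin d → ι) : Set E :=
  convexHull ℝ (Set.range x) ∩ affineSpan ℝ (Set.range (x ∘ τ))

omit [Fintype ι] in
lemma mem_affineSpan_iff_of_affineIndependent (hE : Module.finrank ℝ E = d) {y : Fin d → E}
    (hy : AffineIndependent ℝ y) {f : Module.Dual ℝ E} (hf : f ≠ 0)
    (hc : ∀ i j, f (y i) = f (y j)) (i : Fin d) (p : E) :
    p ∈ affineSpan ℝ (Set.range y) ↔ f p = f (y i) := by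
  have : Nonempty (Fin d) := ⟨i⟩
  have hle : vectorSpan ℝ (Set.range y) ≤ LinearMap.ker f := by
    rw [vectorSpan_def, Submodule.span_le]
    rintro _ ⟨_, ⟨a, rfl⟩, _, ⟨b, rfl⟩, rfl⟩
    simp [hc a b]
  have h1 := hy.finrank_vectorSpan_add_one
  have h2 := Module.Dual.finrank_ker_add_one_of_ne_zero hf
  rw [Fintype.card_fin] at h1
  have heq := Submodule.eq_of_le_of_finrank_eq hle (by omega)
  have hi : y i ∈ affineSpan ℝ (Set.range y) := subset_affineSpan ℝ _ ⟨i, rfl⟩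
  rw [← AffineSubspace.vsub_right_mem_direction_iff_mem hi, direction_affineSpan, heq]
  simp [sub_eq_zero]

omit [Fintype ι] in
lemma finrank_vectorSpan_tupleFace (hE : Module.finrank ℝ E = d) (hd : 0 < d) {x : ι → E}
    {τ : Fin d → ι} (h : IsFacetTuple x τ) :
    (tupleFace x τ).Nonempty ∧ Convex ℝ (tupleFace x τ) ∧
      IsExtreme ℝ (convexHull ℝ (Set.range x)) (tupleFace x τ) ∧
      Module.finrank ℝ (vectorSpan ℝ (tupleFace x τ)) = d - 1 := by
  obtain ⟨hAI, f, hf, hmax⟩ := h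
  let i0 : Fin d := ⟨0, hd⟩
  have : Nonempty (Fin d) := ⟨i0⟩
  have hmem : ∀ i, x (τ i) ∈ tupleFace x τ := fun i =>
    ⟨subset_convexHull ℝ _ ⟨_, rfl⟩, subset_affineSpan ℝ _ ⟨i, rfl⟩⟩
  have hc : ∀ i j, f ((x ∘ τ) i) = f ((x ∘ τ) j) := fun i j =>
    le_antisymm (hmax _ ⟨j, rfl⟩ _) (hmax _ ⟨i, rfl⟩ _)
  have hiff := mem_affineSpan_iff_of_affineIndependent hE hAI hf hc i0
  have hle : ∀ p ∈ convexHull ℝ (Set.range x), f p ≤ f (x (τ i0)) := by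
    intro p hp
    have : convexHull ℝ (Set.range x) ⊆ {p | f p ≤ f (x (τ i0))} :=
      convexHull_min (by rintro _ ⟨j, rfl⟩; exact hmax _ ⟨i0, rfl⟩ _)
        (convex_halfSpace_le f.isLinear _)
    exact this hp
  refine ⟨⟨_, hmem i0⟩, (convex_convexHull ℝ _).inter (AffineSubspace.convex _),
    ⟨Set.inter_subset_left, ?_⟩, ?_⟩
  · rintro a ha b hb z ⟨hz, hz'⟩ hseg
    refine ⟨ha, (hiff _).2 ?_⟩
    obtain ⟨s, t, hs, ht, hst, rfl⟩ := hseg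
    have h1 := (hiff _).1 hz'
    simp only [map_add, map_smul, smul_eq_mul, Function.comp] at h1 ⊢
    have ha' := hle a ha
    have hb' := hle b hb
    refine le_antisymm ha' ?_
    by_contra! hlt
    have : t = 1 - s := by linarith
    subst this
    nlinarith [mul_lt_mul_of_pos_left hlt hs, mul_le_mul_of_nonneg_left hb' ht.le]
  · have h1 := hAI.finrank_vectorSpan_add_one
    rw [Fintype.card_fin] at h1
    have : vectorSpan ℝ (tupleFace x τ) = vectorSpan ℝ (Set.range (x ∘ τ)) := by
      apply le_antisymm
      · rw [← direction_affineSpan ℝ (Set.range (x ∘ τ)), AffineSubspace.direction]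
        exact vectorSpan_mono ℝ Set.inter_subset_right
      · apply vectorSpan_mono
        rintro _ ⟨i, rfl⟩
        exact hmem i
    rw [this]; omega

lemma exists_isFacetTuple (hE : Module.finrank ℝ E = d) (hd : 0 < d) {x : ι → E} {F : Set E}
    (hne : F.Nonempty) (hconv : Convex ℝ F) (hext : IsExtreme ℝ (convexHull ℝ (Set.range x)) F)
    (hrank : Module.finrank ℝ (vectorSpan ℝ F) = d - 1) :
    ∃ τ : Fin d → ι, IsFacetTuple x τ ∧ F = tupleFace x τ := by
  have hspan : affineSpan ℝ (x '' {i | x i ∈ F}) = affineSpan ℝ F := by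
    apply le_antisymm
    · apply affineSpan_mono
      rintro _ ⟨i, hi, rfl⟩
      exact hi
    · rw [← affineSpan_convexHull (x '' _)]
      exact affineSpan_mono ℝ hext.subset_convexHull_image
  obtain ⟨τ, hAI, hτF, hτspan⟩ : ∃ τ : Fin d → ι, AffineIndependent ℝ (x ∘ τ) ∧
      (∀ i, x (τ i) ∈ F) ∧ affineSpan ℝ (Set.range (x ∘ τ)) = affineSpan ℝ F := by
    obtain ⟨t, hts, htspan, htAI⟩ := exists_affineIndependent ℝ E (x '' {i | x i ∈ F})
    have htfin : t.Finite := ((Set.toFinite _).image x).subset hts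
    have := htfin.fintype
    have htne : t.Nonempty := by
      rw [← affineSpan_nonempty ℝ, htspan, hspan, affineSpan_nonempty]
      exact hne
    have := htne.to_subtype
    have hcard := htAI.finrank_vectorSpan_add_one
    rw [Subtype.range_coe, ← direction_affineSpan, htspan, hspan, direction_affineSpan, hrank]
      at hcard
    have hcard' : Fintype.card t = d := by rw [← hcard]; omega
    have e : Fin d ≃ t := (Fintype.equivFinOfCardEq hcard').symm
    have hch : ∀ p : t, ∃ i, x i ∈ F ∧ x i = p := fun p => by
      obtain ⟨i, hi, hip⟩ := hts p.2
      exact ⟨i, hi, hip⟩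
    choose g hg1 hg2 using hch
    have hcomp : x ∘ (g ∘ e) = (fun p : t => (p : E)) ∘ e := by
      funext i; simp [hg2]
    refine ⟨g ∘ e, ?_, fun i => hg1 _, ?_⟩
    · rw [hcomp]; exact htAI.comp_embedding e.toEmbedding
    · rw [hcomp, e.surjective.range_comp, Subtype.range_coe, htspan, hspan]
  have hlt : vectorSpan ℝ F < ⊤ := by
    apply lt_top_iff_ne_top.2
    intro h
    rw [h, finrank_top] at hrank
    omega
  obtain ⟨f, hf, hker⟩ := Submodule.exists_le_ker_of_lt_top _ hlt
  have hkereq : vectorSpan ℝ F = LinearMap.ker f := by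
    refine Submodule.eq_of_le_of_finrank_eq hker ?_
    have := Module.Dual.finrank_ker_add_one_of_ne_zero hf
    omega
  obtain ⟨_, ⟨q, hq, rfl⟩⟩ := hne.intrinsicInterior hconv
  have hqF : (q : E) ∈ F := (interior_subset hq : q ∈ ((↑) ⁻¹' F : Set (affineSpan ℝ F)))
  have hmemspan : ∀ y, f y = f q → y ∈ affineSpan ℝ F := by
    intro y hy
    rw [← AffineSubspace.vsub_right_mem_direction_iff_mem q.2, direction_affineSpan, hkereq]
    simp [hy]
  have hslice : ∀ y ∈ convexHull ℝ (Set.range x), f y = f q → y ∈ F := by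
    intro y hyK hy
    let g : ℝ → affineSpan ℝ F := fun t => ⟨q + t • ((q : E) - y), hmemspan _ (by simp [hy])⟩
    have hg : Continuous g := by
      apply Continuous.subtype_mk
      fun_prop
    have hg0 : g 0 = q := by ext; simp [g]
    have hev : ∀ᶠ t in nhds (0 : ℝ), g t ∈ interior ((↑) ⁻¹' F : Set (affineSpan ℝ F)) := by
      apply hg.continuousAt.eventually_mem
      rw [hg0]
      exact isOpen_interior.mem_nhds hq
    obtain ⟨t, ht, htpos⟩ := ((hev.filter_mono nhdsWithin_le_nhds).and
      (self_mem_nhdsWithin : Set.Ioi (0 : ℝ) ∈ nhdsWithin 0 (Set.Ioi 0))).exists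
    have htpos : 0 < t := htpos
    have htF : (q : E) + t • ((q : E) - y) ∈ F :=
      (interior_subset ht : g t ∈ ((↑) ⁻¹' F : Set (affineSpan ℝ F)))
    refine hext.left_mem_of_mem_openSegment hyK (hext.subset htF) hqF ?_
    refine ⟨t / (1 + t), 1 / (1 + t), by positivity, by positivity, by field_simp; ring, ?_⟩
    have h1 : (1 + t) ≠ 0 := by positivity
    have h2 : t / (1 + t) + 1 / (1 + t) * (1 + t) - t / (1 + t) - 1 = 0 := by field_simp; ring
    calc (t / (1 + t)) • y + (1 / (1 + t)) • ((q : E) + t • ((q : E) - y))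
        = (1 / (1 + t) * (1 + t)) • (q : E) := by
          module
      _ = q := by rw [one_div_mul_cancel h1, one_smul]
  have hFf : ∀ y ∈ F, f y = f q := by
    intro y hy
    have : y -ᵥ (q : E) ∈ LinearMap.ker f := hkereq ▸ vsub_mem_vectorSpan ℝ hy hqF
    simpa [sub_eq_zero] using this
  have hside : (∀ y ∈ convexHull ℝ (Set.range x), f y ≤ f q) ∨
      (∀ y ∈ convexHull ℝ (Set.range x), f q ≤ f y) := by
    by_contra! h
    obtain ⟨⟨b, hb, hb'⟩, a, ha, ha'⟩ := h
    have hab : 0 < f b - f a := by linarith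
    let s := (f b - f q) / (f b - f a)
    have hs : 0 < s := div_pos (by linarith) hab
    have hs' : s < 1 := (div_lt_one hab).2 (by linarith)
    have hfw : f (s • a + (1 - s) • b) = f q := by
      simp only [map_add, map_smul, smul_eq_mul, s]
      field_simp
      ring
    have hwK : s • a + (1 - s) • b ∈ convexHull ℝ (Set.range x) :=
      convex_convexHull ℝ _ ha hb hs.le (by linarith) (by ring)
    have := hext.left_mem_of_mem_openSegment ha hb (hslice _ hwK hfw)
      ⟨s, 1 - s, hs, by linarith, by ring, rfl⟩
    exact ha'.ne (hFf a this)
  refine ⟨τ, ⟨hAI, ?_⟩, ?_⟩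
  · have hx : ∀ j, x j ∈ convexHull ℝ (Set.range x) := fun j => subset_convexHull ℝ _ ⟨j, rfl⟩
    rcases hside with h | h
    · refine ⟨f, hf, ?_⟩
      rintro _ ⟨i, rfl⟩ j
      rw [hFf _ (hτF i)]
      exact h _ (hx j)
    · refine ⟨-f, neg_ne_zero.2 hf, ?_⟩
      rintro _ ⟨i, rfl⟩ j
      simp only [LinearMap.neg_apply, neg_le_neg_iff]
      rw [hFf _ (hτF i)]
      exact h _ (hx j)
  · rw [tupleFace, hτspan]
    refine Set.Subset.antisymm (fun y hy => ⟨hext.subset hy, subset_affineSpan ℝ _ hy⟩) ?_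
    rintro y ⟨hyK, hyA⟩
    refine hslice y hyK ?_
    have := (AffineSubspace.vsub_right_mem_direction_iff_mem q.2 y).2 hyA
    rw [direction_affineSpan, hkereq] at this
    simpa [sub_eq_zero] using this

omit [Fintype ι] in
lemma mem_affineSpan_iff_supported (hE : Module.finrank ℝ E = d) (hd : 0 < d) {x : ι → E}
    {τ : Fin d → ι} (h : IsFacetTuple x τ) (j : ι) :
    x j ∈ affineSpan ℝ (Set.range (x ∘ τ)) ↔ Supported x (insert j (Set.range τ)) := by
  obtain ⟨hAI, f, hf, hmax⟩ := h
  constructor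
  · intro hj
    have hc : ∀ i j, f ((x ∘ τ) i) = f ((x ∘ τ) j) := fun i j =>
      le_antisymm (hmax _ ⟨j, rfl⟩ _) (hmax _ ⟨i, rfl⟩ _)
    have := (mem_affineSpan_iff_of_affineIndependent hE hAI hf hc ⟨0, hd⟩ _).1 hj
    refine ⟨f, hf, ?_⟩
    rintro i (rfl | hi) k
    · rw [this]; exact hmax _ ⟨_, rfl⟩ _
    · exact hmax _ hi _
  · rintro ⟨g, hg, hgmax⟩
    have hc : ∀ i j, g ((x ∘ τ) i) = g ((x ∘ τ) j) := fun i j =>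
      le_antisymm (hgmax _ (.inr ⟨j, rfl⟩) _) (hgmax _ (.inr ⟨i, rfl⟩) _)
    refine (mem_affineSpan_iff_of_affineIndependent hE hAI hg hc ⟨0, hd⟩ _).2 ?_
    exact le_antisymm (hgmax _ (.inr ⟨_, rfl⟩) _) (hgmax _ (.inl rfl) _)

/-- `S` is the set of indices of the points on the hyperplane spanned by some facet tuple. -/
def IsFacetSet (x : ι → E) (d : ℕ) (S : Finset ι) : Prop :=
  ∃ τ : Fin d → ι, IsFacetTuple x τ ∧ ∀ j, j ∈ S ↔ Supported x (insert j (Set.range τ))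

open Classical in
lemma faceCount_eq_card (hE : Module.finrank ℝ E = d) (hd : 0 < d) (x : ι → E) :
    faceCount (convexHull ℝ (Set.range x)) (d - 1) =
      (Finset.univ.filter fun S : Finset ι => IsFacetSet x d S).card := by
  have hsub : ∀ τ τ' : Fin d → ι, IsFacetTuple x τ → IsFacetTuple x τ' →
      (∀ j, Supported x (insert j (Set.range τ)) ↔ Supported x (insert j (Set.range τ'))) →
      tupleFace x τ ⊆ tupleFace x τ' := by
    intro τ τ' h h' hiff
    refine Set.inter_subset_inter_right _ ?_
    refine affineSpan_le.2 ?_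
    rintro _ ⟨i, rfl⟩
    exact (mem_affineSpan_iff_supported hE hd h' _).2 ((hiff _).1
      ((mem_affineSpan_iff_supported hE hd h _).1 (subset_affineSpan ℝ _ ⟨i, rfl⟩)))
  rw [← Fintype.card_subtype, ← Nat.card_eq_fintype_card]
  symm
  refine Nat.card_congr (Equiv.ofBijective
    (fun S => ⟨tupleFace x S.2.choose,
      finrank_vectorSpan_tupleFace hE hd S.2.choose_spec.1⟩) ⟨?_, ?_⟩)
  · rintro ⟨S, hS⟩ ⟨S', hS'⟩ heq
    have heq : tupleFace x hS.choose = tupleFace x hS'.choose := congrArg Subtype.val heq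
    ext j
    simp only
    rw [hS.choose_spec.2, hS'.choose_spec.2,
      ← mem_affineSpan_iff_supported hE hd hS.choose_spec.1,
      ← mem_affineSpan_iff_supported hE hd hS'.choose_spec.1]
    have hx : x j ∈ convexHull ℝ (Set.range x) := subset_convexHull ℝ _ ⟨j, rfl⟩
    have := Set.ext_iff.1 heq (x j)
    simpa only [tupleFace, Set.mem_inter_iff, hx, true_and, SetLike.mem_coe] using this
  · rintro ⟨F, h1, h2, h3, h4⟩
    obtain ⟨τ, hτ, rfl⟩ := exists_isFacetTuple hE hd h1 h2 h3 h4
    have hS : IsFacetSet x d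
        (Finset.univ.filter fun j => Supported x (insert j (Set.range τ))) :=
      ⟨τ, hτ, by simp⟩
    refine ⟨⟨_, hS⟩, Subtype.ext ?_⟩
    have h := hS.choose_spec
    have hiff : ∀ j, Supported x (insert j (Set.range τ)) ↔
        Supported x (insert j (Set.range hS.choose)) := fun j => by
      rw [← h.2 j]; simp
    exact Set.Subset.antisymm (hsub _ _ h.1 hτ fun j => (hiff j).symm) (hsub _ _ hτ h.1 hiff)

open Classical in
lemma faceCount_le_card (hE : Module.finrank ℝ E = d) (hd : 0 < d) (x : ι → E) :
    faceCount (convexHull ℝ (Set.range x)) (d - 1) ≤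
      (Finset.univ.filter fun τ : Fin d → ι => IsFacetTuple x τ).card := by
  rw [← Fintype.card_subtype, ← Nat.card_eq_fintype_card]
  refine Nat.card_le_card_of_surjective (fun τ => ⟨tupleFace x τ.1,
    finrank_vectorSpan_tupleFace hE hd τ.2⟩) ?_
  rintro ⟨F, h1, h2, h3, h4⟩
  obtain ⟨τ, hτ, rfl⟩ := exists_isFacetTuple hE hd h1 h2 h3 h4
  exact ⟨⟨τ, hτ⟩, rfl⟩

lemma card_le_faceCount (hE : Module.finrank ℝ E = d) (hd : 0 < d) (x : ι → E)
    {α : Type*} (s : Finset α) (τ : α → Fin d → ι) (h : ∀ a ∈ s, IsFacetTuple x (τ a))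
    (hinj : ∀ a ∈ s, ∀ b ∈ s, tupleFace x (τ a) = tupleFace x (τ b) → a = b) :
    s.card ≤ faceCount (convexHull ℝ (Set.range x)) (d - 1) := by
  classical
  rw [← Fintype.card_coe, ← Nat.card_eq_fintype_card]
  have : Finite {F : Set E // F.Nonempty ∧ Convex ℝ F ∧
      IsExtreme ℝ (convexHull ℝ (Set.range x)) F ∧
      Module.finrank ℝ (vectorSpan ℝ F) = d - 1} := by
    refine Finite.of_surjective (fun τ : {τ : Fin d → ι // IsFacetTuple x τ} =>
      ⟨tupleFace x τ.1, finrank_vectorSpan_tupleFace hE hd τ.2⟩) ?_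
    rintro ⟨F, h1, h2, h3, h4⟩
    obtain ⟨τ, hτ, rfl⟩ := exists_isFacetTuple hE hd h1 h2 h3 h4
    exact ⟨⟨τ, hτ⟩, rfl⟩
  refine Nat.card_le_card_of_injective (fun a : s => ⟨tupleFace x (τ a),
    finrank_vectorSpan_tupleFace hE hd (h a a.2)⟩) ?_
  intro a b hab
  exact Subtype.ext (hinj a a.2 b b.2 (congrArg Subtype.val hab))

end Facets

section Measurability

variable {ι : Type*} {d : ℕ}

lemma supported_iff_dotProduct {x : ι → Fin d → ℝ} {S : Set ι} :
    Supported x S ↔ ∃ u : Fin d → ℝ, u ≠ 0 ∧ ∀ i ∈ S, ∀ j, u ⬝ᵥ x j ≤ u ⬝ᵥ x i := by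
  constructor
  · rintro ⟨f, hf, h⟩
    have hfu : ∀ y, f y = (fun i => f (Pi.single i 1)) ⬝ᵥ y := by
      intro y
      rw [LinearMap.pi_apply_eq_sum_univ f y]
      simp only [dotProduct, smul_eq_mul, mul_comm]
      congr! with i hi j
      simp [Pi.single_apply, eq_comm]
    refine ⟨fun i => f (Pi.single i 1), fun h0 => hf ?_, fun i hi j => ?_⟩
    · ext y
      simpa using congrFun h0 y
    · rw [← hfu, ← hfu]; exact h i hi j
  · rintro ⟨u, hu, h⟩
    refine ⟨dotProductBilin ℝ ℝ u, fun h0 => hu ?_, fun i hi j => h i hi j⟩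
    funext i
    have := LinearMap.congr_fun h0 (Pi.single i 1)
    simpa [dotProductBilin] using this

lemma isClosed_supported (S : Set ι) : IsClosed {x : ι → Fin d → ℝ | Supported x S} := by
  have hclosed : IsClosed {p : (ι → Fin d → ℝ) × Metric.sphere (0 : Fin d → ℝ) 1 |
      ∀ i ∈ S, ∀ j, (p.2 : Fin d → ℝ) ⬝ᵥ p.1 j ≤ (p.2 : Fin d → ℝ) ⬝ᵥ p.1 i} := by
    simp only [Set.ofPred_forall]
    refine isClosed_iInter fun i => isClosed_iInter fun _ => isClosed_iInter fun j =>
      isClosed_le ?_ ?_ <;> unfold dotProduct <;> refine continuous_finsetSum _ fun k _ => ?_ <;>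
        exact ((continuous_apply k).comp (continuous_subtype_val.comp continuous_snd)).mul
          ((continuous_apply_apply _ k).comp continuous_fst)
  convert! isClosedMap_fst_of_compactSpace _ hclosed
  ext x
  simp only [Set.mem_ofPred_eq, supported_iff_dotProduct, Set.mem_image, Prod.exists,
    exists_and_right, exists_eq_right]
  constructor
  · rintro ⟨u, hu, h⟩
    refine ⟨⟨‖u‖⁻¹ • u, by simp [norm_smul, hu]⟩, fun i hi j => ?_⟩
    simp only [smul_dotProduct, smul_eq_mul]
    exact mul_le_mul_of_nonneg_left (h i hi j) (by positivity)
  · rintro ⟨⟨u, hu⟩, h⟩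
    refine ⟨u, fun h0 => ?_, h⟩
    simp [h0] at hu

lemma measurable_faceCount_convexHull (hd : 0 < d) (n : ℕ) :
    Measurable fun x : Fin n → Fin d → ℝ =>
      (faceCount (convexHull ℝ (Set.range x)) (d - 1) : ℝ) := by
  classical
  have hE : Module.finrank ℝ (Fin d → ℝ) = d := by simp
  simp only [faceCount_eq_card hE hd, Finset.card_filter, Nat.cast_sum]
  refine Finset.measurable_sum _ fun S _ => ?_
  simp only [Nat.cast_ite]
  refine Measurable.ite ?_ measurable_const measurable_const
  simp only [IsFacetSet, IsFacetTuple, Set.ofPred_exists, Set.ofPred_and, Set.ofPred_forall]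
  refine MeasurableSet.iUnion fun τ => .inter (.inter ?_ ?_) (.iInter fun j => ?_)
  · have : IsOpen {p : Fin d → Fin d → ℝ | AffineIndependent ℝ p} :=
      isOpen_setOfPred_affineIndependent
    exact (this.preimage (f := fun x : Fin n → Fin d → ℝ => x ∘ τ)
      (by unfold Function.comp; fun_prop)).measurableSet
  · exact (isClosed_supported _).measurableSet
  · by_cases hj : j ∈ S
    · simpa [hj] using (isClosed_supported _).measurableSet
    · simp only [hj, false_iff]
      exact (isClosed_supported (d := d) (insert j (Set.range τ))).measurableSet.compl

end Measurability

section BetaMeasure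

variable {β : ℝ}

lemma betaConst1_pos (hβ : 0 ≤ β) : 0 < betaConst1 β := by
  have h1 := Real.Gamma_pos_of_pos (by linarith : 0 < 3 / 2 + β)
  have h2 := Real.Gamma_pos_of_pos (by linarith : 0 < β + 1)
  have := Real.pi_pos
  unfold betaConst1
  positivity

lemma betaConst1_eq (hβ : 0 ≤ β) :
    betaConst1 β = 1 / 2 * (1 / ProbabilityTheory.beta (β + 1) (β + 1)) * (1 / 4) ^ β := by
  have h1 := Real.Gamma_pos_of_pos (by linarith : 0 < 3 / 2 + β)
  have h2 := Real.Gamma_pos_of_pos (by linarith : 0 < β + 1)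
  have h3 := Real.Gamma_pos_of_pos (by linarith : 0 < β + 1 + (β + 1))
  have hdup := Real.Gamma_mul_Gamma_add_half (β + 1)
  rw [show β + 1 + 1 / 2 = 3 / 2 + β by ring, show 2 * (β + 1) = β + 1 + (β + 1) by ring,
    show 1 - (β + 1 + (β + 1)) = -1 + (-2) * β by ring, Real.rpow_add two_pos,
    Real.rpow_mul two_pos.le, Real.sqrt_eq_rpow] at hdup
  have h4 : (2 : ℝ) ^ (-2 : ℝ) = 1 / 4 := by
    rw [Real.rpow_neg two_pos.le]; norm_num
  have h5 : (2 : ℝ) ^ (-1 : ℝ) = 1 / 2 := by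
    rw [Real.rpow_neg two_pos.le]; norm_num
  rw [h4, h5] at hdup
  have hpi : 0 < Real.pi ^ ((1 : ℝ) / 2) := Real.rpow_pos_of_pos Real.pi_pos _
  unfold betaConst1 ProbabilityTheory.beta
  generalize Real.Gamma (3 / 2 + β) = a, Real.Gamma (β + 1) = b,
    Real.Gamma (β + 1 + (β + 1)) = c at *
  field_simp
  linear_combination 2 * hdup

lemma isProbabilityMeasure_betaMeasure1 (hβ : 0 ≤ β) :
    IsProbabilityMeasure (betaMeasure1 β) := by
  refine ⟨?_⟩
  rw [betaMeasure1, withDensity_apply _ MeasurableSet.univ, Measure.restrict_univ]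
  have hae : (fun t : ℝ => ENNReal.ofReal
      (if |t| ≤ 1 then betaConst1 β * (1 - t ^ 2) ^ β else 0)) =ᵐ[volume] fun t : ℝ =>
      ENNReal.ofReal (1 / 2) *
        ProbabilityTheory.betaPDF (β + 1) (β + 1) ((1 / 2) * t + 1 / 2) := by
    have h1 : ∀ᵐ t : ℝ, t ≠ 1 := by simp [ae_iff]
    have h2 : ∀ᵐ t : ℝ, t ≠ -1 := by simp [ae_iff]
    filter_upwards [h1, h2] with t ht1 ht2
    by_cases ht : |t| ≤ 1
    · have hl : -1 < t := lt_of_le_of_ne (abs_le.1 ht).1 (Ne.symm ht2)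
      have hr : t < 1 := lt_of_le_of_ne (abs_le.1 ht).2 ht1
      rw [if_pos ht, ProbabilityTheory.betaPDF_of_pos_lt_one (by linarith) (by linarith),
        ← ENNReal.ofReal_mul (by norm_num), betaConst1_eq hβ]
      congr 1
      rw [show 1 - t ^ 2 = 4 * (1 / 2 * t + 1 / 2) * (1 - (1 / 2 * t + 1 / 2)) by ring,
        Real.mul_rpow (by linarith) (by linarith), Real.mul_rpow (by norm_num) (by linarith),
        show β + 1 - 1 = β by ring]
      have : ((1 : ℝ) / 4) ^ β * 4 ^ β = 1 := by
        rw [← Real.mul_rpow (by norm_num) (by norm_num)]; norm_num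
      linear_combination (1 / 2 * (1 / ProbabilityTheory.beta (β + 1) (β + 1)) *
        (1 / 2 * t + 1 / 2) ^ β * (1 - (1 / 2 * t + 1 / 2)) ^ β) * this
    · rw [if_neg ht]
      rw [not_le, lt_abs] at ht
      rcases ht with ht | ht
      · rw [ProbabilityTheory.betaPDF_eq_zero_of_one_le (by linarith)]; simp
      · rw [ProbabilityTheory.betaPDF_eq_zero_of_nonpos (by linarith)]; simp
  have hmeas : Measurable (ProbabilityTheory.betaPDF (β + 1) (β + 1)) := by
    unfold ProbabilityTheory.betaPDF
    fun_prop
  rw [lintegral_congr_ae hae, lintegral_const_mul _ (by fun_prop)]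
  have hmap := Real.map_volume_mul_left (a := 1 / 2) (by norm_num)
  have : ∫⁻ t : ℝ, ProbabilityTheory.betaPDF (β + 1) (β + 1) (1 / 2 * t + 1 / 2) =
      ∫⁻ s, ProbabilityTheory.betaPDF (β + 1) (β + 1) (s + 1 / 2)
        ∂(Measure.map (fun t : ℝ => 1 / 2 * t) volume) := by
    rw [lintegral_map (by fun_prop) (by fun_prop)]
  rw [this, hmap, lintegral_smul_measure,
    lintegral_add_right_eq_self (ProbabilityTheory.betaPDF (β + 1) (β + 1)),
    ProbabilityTheory.lintegral_betaPDF_eq_one (by linarith) (by linarith), smul_eq_mul, mul_one,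
    ← ENNReal.ofReal_mul (by norm_num)]
  norm_num

lemma ae_betaMeasure1_mem_Ioo : ∀ᵐ t ∂betaMeasure1 β, t ∈ Set.Ioo (-1 : ℝ) 1 := by
  rw [betaMeasure1, ae_withDensity_iff (by
    refine ENNReal.measurable_ofReal.comp (Measurable.ite ?_ (by fun_prop) measurable_const)
    exact measurableSet_le (by fun_prop) measurable_const)]
  have h1 : ∀ᵐ t : ℝ, t ≠ 1 := by simp [ae_iff]
  have h2 : ∀ᵐ t : ℝ, t ≠ -1 := by simp [ae_iff]
  filter_upwards [h1, h2] with t ht1 ht2 h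
  have ht : |t| ≤ 1 := by
    by_contra ht
    simp [ht] at h
  exact ⟨lt_of_le_of_ne (abs_le.1 ht).1 (Ne.symm ht2), lt_of_le_of_ne (abs_le.1 ht).2 ht1⟩

lemma volume_one_sub_mul_mem_Icc {s : ℝ} (hs : s = 1 ∨ s = -1) (p q : ℝ) :
    MeasurableSet {t : ℝ | 1 - s * t ∈ Set.Icc p q} ∧
    volume {t : ℝ | 1 - s * t ∈ Set.Icc p q} = ENNReal.ofReal (q - p) := by
  refine ⟨(by fun_prop : Measurable fun t : ℝ => 1 - s * t) measurableSet_Icc, ?_⟩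
  rcases hs with rfl | rfl
  · rw [show {t : ℝ | 1 - 1 * t ∈ Set.Icc p q} = Set.Icc (1 - q) (1 - p) by
      ext t; simp only [Set.mem_ofPred_eq, Set.mem_Icc]; constructor <;> rintro ⟨h, h'⟩ <;>
        constructor <;> linarith, Real.volume_Icc]
    ring_nf
  · rw [show {t : ℝ | 1 - (-1) * t ∈ Set.Icc p q} = Set.Icc (p - 1) (q - 1) by
      ext t; simp only [Set.mem_ofPred_eq, Set.mem_Icc]; constructor <;> rintro ⟨h, h'⟩ <;>
        constructor <;> linarith, Real.volume_Icc]
    ring_nf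

lemma betaMeasure1_le (hβ : 0 ≤ β) {s : ℝ} (hs : s = 1 ∨ s = -1) {b : ℝ} (hb : 0 ≤ b) :
    betaMeasure1 β {t | 1 - s * t ∈ Set.Icc 0 b} ≤
      ENNReal.ofReal (betaConst1 β * 2 ^ β * b ^ (β + 1)) := by
  obtain ⟨hm, hv⟩ := volume_one_sub_mul_mem_Icc hs 0 b
  rw [betaMeasure1, withDensity_apply _ hm]
  calc _ ≤ ∫⁻ _ in {t | 1 - s * t ∈ Set.Icc 0 b}, ENNReal.ofReal (betaConst1 β * (2 * b) ^ β) := by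
        refine setLIntegral_mono' hm fun t ht => ENNReal.ofReal_le_ofReal ?_
        have hc := betaConst1_pos hβ
        split_ifs with h
        · have h2 := abs_le.1 h
          refine mul_le_mul_of_nonneg_left (Real.rpow_le_rpow (by nlinarith) ?_ hβ) hc.le
          have ht : 0 ≤ 1 - s * t ∧ 1 - s * t ≤ b := ht
          rcases hs with rfl | rfl <;> nlinarith
        · positivity
    _ = _ := by
        rw [setLIntegral_const, hv, ← ENNReal.ofReal_mul (by
          have := betaConst1_pos hβ; positivity), sub_zero, Real.mul_rpow two_pos.le hb,
          Real.rpow_add_one' hb (by linarith)]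
        ring_nf

lemma le_betaMeasure1 (hβ : 0 ≤ β) {s : ℝ} (hs : s = 1 ∨ s = -1) {b : ℝ} (hb : 0 ≤ b)
    (hb1 : b ≤ 1) :
    ENNReal.ofReal (betaConst1 β * (b / 2) ^ (β + 1)) ≤
      betaMeasure1 β {t | 1 - s * t ∈ Set.Icc (b / 2) b} := by
  obtain ⟨hm, hv⟩ := volume_one_sub_mul_mem_Icc hs (b / 2) b
  rw [betaMeasure1, withDensity_apply _ hm]
  calc _ = ∫⁻ _ in {t | 1 - s * t ∈ Set.Icc (b / 2) b},
        ENNReal.ofReal (betaConst1 β * (b / 2) ^ β) := by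
        rw [setLIntegral_const, hv, ← ENNReal.ofReal_mul (by
          have := betaConst1_pos hβ; positivity),
          Real.rpow_add_one' (by positivity) (by linarith)]
        ring_nf
    _ ≤ _ := by
        refine setLIntegral_mono' hm fun t ht => ENNReal.ofReal_le_ofReal ?_
        have hc := betaConst1_pos hβ
        have ht : b / 2 ≤ 1 - s * t ∧ 1 - s * t ≤ b := ht
        rw [if_pos (by rw [abs_le]; rcases hs with rfl | rfl <;> constructor <;> linarith)]
        refine mul_le_mul_of_nonneg_left (Real.rpow_le_rpow (by positivity) ?_ hβ) hc.le
        rcases hs with rfl | rfl <;> nlinarith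

/-- The ratio of the geometric scale along which `betaMeasure1 β` of a neighbourhood of an
endpoint halves. -/
def halvingRatio (β : ℝ) : ℝ := (1 / 2) ^ (1 / (β + 1))

lemma halvingRatio_pos (β : ℝ) : 0 < halvingRatio β := by unfold halvingRatio; positivity

lemma halvingRatio_lt_one (hβ : 0 ≤ β) : halvingRatio β < 1 :=
  Real.rpow_lt_one (by norm_num) (by norm_num) (by positivity)

lemma halvingRatio_pow_rpow (hβ : 0 ≤ β) (k : ℕ) :
    (halvingRatio β ^ k) ^ (β + 1) = (1 / 2) ^ k := by
  have : β + 1 ≠ 0 := by positivity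
  have h : halvingRatio β ^ (β + 1) = 1 / 2 := by
    rw [halvingRatio, ← Real.rpow_mul (by norm_num), one_div_mul_cancel this, Real.rpow_one]
  rw [← Real.rpow_natCast, ← Real.rpow_mul (halvingRatio_pos β).le, mul_comm (k : ℝ),
    Real.rpow_mul (halvingRatio_pos β).le, h, Real.rpow_natCast]

lemma exists_betaMeasure1_le (hβ : 0 ≤ β) (θ : ℝ) (hθ : 0 < θ) : ∃ A > 0, ∀ s : ℝ, s = 1 ∨ s = -1 →
    ∀ k : ℕ, betaMeasure1 β {t | 1 - s * t ∈ Set.Icc 0 (θ * halvingRatio β ^ k)} ≤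
      ENNReal.ofReal (A * (1 / 2) ^ k) := by
  have hc := betaConst1_pos hβ
  refine ⟨betaConst1 β * 2 ^ β * θ ^ (β + 1), by positivity, fun s hs k => ?_⟩
  have hr := halvingRatio_pos β
  convert! betaMeasure1_le hβ hs (b := θ * halvingRatio β ^ k) (by positivity) using 2
  rw [Real.mul_rpow hθ.le (by positivity), halvingRatio_pow_rpow hβ]
  ring

lemma exists_le_betaMeasure1 (hβ : 0 ≤ β) (θ : ℝ) (hθ : 0 < θ) (hθ1 : θ ≤ 1) :
    ∃ A > 0, ∀ s : ℝ, s = 1 ∨ s = -1 → ∀ k : ℕ, ENNReal.ofReal (A * (1 / 2) ^ k) ≤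
      betaMeasure1 β {t | 1 - s * t ∈
        Set.Icc (θ * halvingRatio β ^ k / 2) (θ * halvingRatio β ^ k)} := by
  have hc := betaConst1_pos hβ
  refine ⟨betaConst1 β * (θ / 2) ^ (β + 1), by positivity, fun s hs k => ?_⟩
  have hr := halvingRatio_pos β
  have hk : halvingRatio β ^ k ≤ 1 := pow_le_one₀ hr.le (halvingRatio_lt_one hβ).le
  convert! le_betaMeasure1 hβ hs (b := θ * halvingRatio β ^ k) (by positivity)
    (mul_le_one₀ hθ1 (by positivity) hk) using 2
  rw [mul_div_right_comm, Real.mul_rpow (by positivity) (by positivity),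
    halvingRatio_pow_rpow hβ]
  ring

end BetaMeasure

section Sums

open scoped ENNReal

lemma tsum_sum_fin_le (e : ℕ) (g : ℕ → ℝ≥0∞) :
    ∑' k : Fin (e + 1) → ℕ, g (∑ i, k i) ≤ ∑' s : ℕ, ((s : ℝ≥0∞) + 1) ^ e * g s := by
  induction e generalizing g with
  | zero =>
    rw [← (Equiv.funUnique (Fin 1) ℕ).symm.tsum_eq]
    simp
  | succ e ih =>
    rw [← (Fin.consEquiv fun _ : Fin (e + 2) => ℕ).tsum_eq, ENNReal.tsum_prod']
    simp only [Fin.consEquiv_apply, Fin.sum_univ_succ (n := e + 1), Fin.cons_zero, Fin.cons_succ]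
    calc _ ≤ ∑' a : ℕ, ∑' s : ℕ, ((s : ℝ≥0∞) + 1) ^ e * g (a + s) :=
          ENNReal.tsum_le_tsum fun a => ih fun s => g (a + s)
      _ = ∑' p : ℕ × ℕ, ((p.2 : ℝ≥0∞) + 1) ^ e * g (p.1 + p.2) := by rw [ENNReal.tsum_prod']
      _ = ∑' t : ℕ, ∑ p ∈ Finset.HasAntidiagonal.antidiagonal t,
          ((p.2 : ℝ≥0∞) + 1) ^ e * g (p.1 + p.2) := by
          rw [← Finset.HasAntidiagonal.sigmaAntidiagonalEquivProd.tsum_eq, ENNReal.tsum_sigma']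
          congr! with t
          rw [tsum_fintype]
          exact Finset.sum_coe_sort (Finset.HasAntidiagonal.antidiagonal t)
            fun p => ((p.2 : ℝ≥0∞) + 1) ^ e * g (p.1 + p.2)
      _ ≤ _ := by
          refine ENNReal.tsum_le_tsum fun t => ?_
          calc _ ≤ ∑ p ∈ Finset.HasAntidiagonal.antidiagonal t, ((t : ℝ≥0∞) + 1) ^ e * g t := by
                refine Finset.sum_le_sum fun p hp => ?_
                rw [Finset.HasAntidiagonal.mem_antidiagonal] at hp
                rw [hp]
                gcongr
                omega
            _ = _ := by
                rw [Finset.sum_const, Finset.Nat.card_antidiagonal, nsmul_eq_mul, pow_succ']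
                push_cast
                ring

lemma tsum_dist_le (N : ℕ) (F : ℕ → ℝ≥0∞) : ∑' s, F (Nat.dist s N) ≤ 2 * ∑' j, F j := by
  have hinj : Function.Injective fun s : ℕ => (decide (s ≤ N), Nat.dist s N) := by
    intro s t h
    simp only [Prod.mk.injEq, decide_eq_decide, Nat.dist] at h
    omega
  calc ∑' s, F (Nat.dist s N) ≤ ∑' p : Bool × ℕ, F p.2 :=
        ENNReal.tsum_comp_le_tsum_of_injective hinj fun p => F p.2
    _ = 2 * ∑' j, F j := by
        rw [ENNReal.tsum_prod', tsum_bool]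
        ring

lemma pow_mul_exp_neg_le {v b : ℝ} (hv : 0 < v) (hb : 0 < b) (d : ℕ) :
    v ^ d * Real.exp (-(b * v)) ≤ (d + 1).factorial / b ^ (d + 1) * v⁻¹ := by
  have h := Real.pow_div_factorial_le_exp (b * v) (by positivity) (d + 1)
  rw [Real.exp_neg, ← div_eq_mul_inv, ← div_eq_mul_inv, div_le_div_iff₀ (Real.exp_pos _) hv]
  rw [div_le_iff₀ (by positivity), mul_pow] at h
  rw [div_mul_eq_mul_div, le_div_iff₀ (by positivity)]
  calc _ = b ^ (d + 1) * v ^ (d + 1) := by ring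
    _ ≤ _ := h
    _ = _ := by ring

/-- The decay of the contribution of the boxes of measure about `2 ^ (-s)`. -/
lemma exists_scale_term_le {d : ℕ} (hd : 0 < d) {A B : ℝ} (hA : 0 < A) (hB : 0 < B) :
    ∃ K > 0, ∀ n : ℕ, 2 * d ≤ n → ∀ s : ℕ,
      (s + 1 : ℝ) ^ (d - 1) * (n ^ d * ((A * (1 / 2) ^ s) ^ d *
        Real.exp (-(B * (1 / 2) ^ s * (n - d : ℕ))))) ≤
      (Nat.log 2 n + 1 : ℝ) ^ (d - 1) * (K * ((Nat.dist s (Nat.log 2 n) + 1 : ℝ) ^ (d - 1) *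
        (1 / 2) ^ Nat.dist s (Nat.log 2 n))) := by
  refine ⟨A ^ d * ((d + 1).factorial / (B / 2) ^ (d + 1) + 2), by positivity, fun n hn s => ?_⟩
  set N := Nat.log 2 n with hN
  set j := Nat.dist s N with hj
  have hn0 : n ≠ 0 := by omega
  have hn0' : (0 : ℝ) < n := by positivity
  set v : ℝ := n * (1 / 2) ^ s with hv
  have hvpos : 0 < v := by positivity
  have hlow : (2 : ℝ) ^ N ≤ n := by exact_mod_cast Nat.pow_log_le_self 2 hn0
  have hup : (n : ℝ) ≤ 2 ^ (N + 1) := by exact_mod_cast (Nat.lt_pow_succ_log_self one_lt_two n).le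
  have hexp : Real.exp (-(B * (1 / 2) ^ s * (n - d : ℕ))) ≤ Real.exp (-(B / 2 * v)) := by
    rw [Real.exp_le_exp, neg_le_neg_iff, hv]
    have : (n : ℝ) / 2 ≤ (n - d : ℕ) := by
      rw [Nat.cast_sub (by omega)]
      have : (2 * d : ℝ) ≤ n := by exact_mod_cast hn
      linarith
    calc B / 2 * (n * (1 / 2) ^ s) = B * (1 / 2) ^ s * (n / 2) := by ring
      _ ≤ _ := by gcongr
  have hterm : v ^ d * Real.exp (-(B / 2 * v)) ≤
      ((d + 1).factorial / (B / 2) ^ (d + 1) + 2) * (1 / 2) ^ j := by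
    have hc : (0 : ℝ) < (d + 1).factorial / (B / 2) ^ (d + 1) := by positivity
    rcases le_or_gt s N with hs | hs
    · have hjs : j = N - s := by simp only [hj, Nat.dist]; omega
      have hvinv : v⁻¹ ≤ (1 / 2) ^ j := by
        rw [one_div, inv_pow]
        refine inv_anti₀ (by positivity) ?_
        rw [hv, one_div, inv_pow, ← div_eq_mul_inv, le_div_iff₀ (by positivity), ← pow_add, hjs,
          Nat.sub_add_cancel hs]
        exact hlow
      calc _ ≤ _ := pow_mul_exp_neg_le hvpos (by positivity) d
        _ ≤ (d + 1).factorial / (B / 2) ^ (d + 1) * (1 / 2) ^ j := by gcongr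
        _ ≤ _ := by gcongr; linarith
    · have hjs : s = N + j := by simp only [hj, Nat.dist]; omega
      have hj1 : 1 ≤ j := by omega
      have hv2 : v ≤ 2 * (1 / 2) ^ j := by
        have hpow : (2 : ℝ) ^ N * (1 / 2) ^ N = 1 := by rw [← mul_pow]; norm_num
        have hs2 : ((1 : ℝ) / 2) ^ s = (1 / 2) ^ N * (1 / 2) ^ j := by rw [← pow_add, ← hjs]
        calc v ≤ 2 ^ (N + 1) * (1 / 2) ^ s := mul_le_mul_of_nonneg_right hup (by positivity)
          _ = 2 * (1 / 2) ^ j := by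
            rw [hs2, pow_succ]
            linear_combination 2 * (1 / 2) ^ j * hpow
      have hv1 : v ≤ 1 := by
        have : ((1 : ℝ) / 2) ^ j ≤ (1 / 2) ^ 1 :=
          pow_le_pow_of_le_one (by norm_num) (by norm_num) hj1
        linarith
      calc v ^ d * Real.exp (-(B / 2 * v)) ≤ v ^ d * 1 := by
            gcongr
            rw [Real.exp_le_one_iff, neg_nonpos]
            positivity
        _ ≤ v := by rw [mul_one]; exact pow_le_of_le_one hvpos.le hv1 hd.ne'
        _ ≤ 2 * (1 / 2) ^ j := hv2
        _ ≤ _ := by gcongr; linarith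
  have hsN : (s + 1 : ℝ) ≤ (N + 1) * (j + 1) := by
    have : s ≤ N + j := by simp only [hj, Nat.dist]; omega
    have : (s : ℝ) ≤ N + j := by exact_mod_cast this
    nlinarith [Nat.cast_nonneg (α := ℝ) N, Nat.cast_nonneg (α := ℝ) j]
  calc _ ≤ ((N + 1) * (j + 1) : ℝ) ^ (d - 1) * (n ^ d * ((A * (1 / 2) ^ s) ^ d *
        Real.exp (-(B / 2 * v)))) := by gcongr
    _ = ((N + 1) * (j + 1) : ℝ) ^ (d - 1) * (A ^ d * (v ^ d * Real.exp (-(B / 2 * v)))) := by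
        rw [hv]; ring
    _ ≤ ((N + 1) * (j + 1) : ℝ) ^ (d - 1) * (A ^ d *
        (((d + 1).factorial / (B / 2) ^ (d + 1) + 2) * (1 / 2) ^ j)) := by gcongr
    _ = _ := by rw [mul_pow]; ring

lemma natLog_add_one_le {n : ℕ} (hn : 2 ≤ n) : (Nat.log 2 n + 1 : ℝ) ≤ 4 * Real.log n := by
  have h2 : (1 : ℝ) / 2 < Real.log 2 := by linarith [Real.log_two_gt_d9]
  have h2' : Real.log 2 < 1 := by linarith [Real.log_two_lt_d9]
  have h1 : (2 : ℝ) ^ Nat.log 2 n ≤ n := by exact_mod_cast Nat.pow_log_le_self 2 (by omega)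
  have h3 := Real.log_le_log (by positivity) h1
  rw [Real.log_pow] at h3
  have h4 : 0.6 < Real.log 2 := by linarith [Real.log_two_gt_d9]
  have h5 : (1 : ℝ) ≤ Nat.log 2 n := by
    exact_mod_cast (Nat.le_log_iff_pow_le one_lt_two (by omega)).2 (by simpa using hn)
  nlinarith

lemma exists_tsum_scale_le {d : ℕ} (hd : 0 < d) {A B : ℝ} (hA : 0 < A) (hB : 0 < B) :
    ∃ C > 0, ∀ n : ℕ, 2 * d ≤ n → (n : ℝ≥0∞) ^ d * ∑' k : Fin d → ℕ,
      ENNReal.ofReal ((A * (1 / 2) ^ ∑ i, k i) ^ d *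
        Real.exp (-(B * (1 / 2) ^ (∑ i, k i) * (n - d : ℕ)))) ≤
      ENNReal.ofReal (C * Real.log n ^ (d - 1)) := by
  obtain ⟨K, hK, hterm⟩ := exists_scale_term_le hd hA hB
  obtain ⟨e, rfl⟩ : ∃ e, d = e + 1 := ⟨d - 1, by omega⟩
  have hsum : Summable fun j : ℕ => K * ((j + 1 : ℝ) ^ e * (1 / 2) ^ j) := by
    refine Summable.mul_left _ ?_
    have h := (summable_nat_add_iff 1).2
      (summable_pow_mul_geometric_of_norm_lt_one (R := ℝ) e (r := 1 / 2) (by norm_num))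
    convert h.mul_left 2 using 2 with j
    push_cast
    ring
  set Z := ∑' j : ℕ, K * ((j + 1 : ℝ) ^ e * (1 / 2) ^ j) with hZ
  have hZpos : 0 ≤ Z := tsum_nonneg fun j => by positivity
  refine ⟨4 ^ e * (2 * Z + 1), by positivity, fun n hn => ?_⟩
  have hn2 : 2 ≤ n := by omega
  set N := Nat.log 2 n with hN
  have hlog : 0 ≤ Real.log n := Real.log_nonneg (by exact_mod_cast (by omega : 1 ≤ n))
  calc _ ≤ (n : ℝ≥0∞) ^ (e + 1) * ∑' s : ℕ, ((s : ℝ≥0∞) + 1) ^ e *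
        ENNReal.ofReal ((A * (1 / 2) ^ s) ^ (e + 1) *
          Real.exp (-(B * (1 / 2) ^ s * (n - (e + 1) : ℕ)))) := by
        gcongr
        exact tsum_sum_fin_le e fun s => ENNReal.ofReal ((A * (1 / 2) ^ s) ^ (e + 1) *
          Real.exp (-(B * (1 / 2) ^ s * (n - (e + 1) : ℕ))))
    _ ≤ ∑' s : ℕ, ENNReal.ofReal ((N + 1 : ℝ) ^ e) *
        ENNReal.ofReal (K * ((Nat.dist s N + 1 : ℝ) ^ e * (1 / 2) ^ Nat.dist s N)) := by
        rw [← ENNReal.tsum_mul_left]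
        refine ENNReal.tsum_le_tsum fun s => ?_
        rw [← ENNReal.ofReal_mul (by positivity)]
        refine le_trans (le_of_eq ?_) (ENNReal.ofReal_le_ofReal (hterm n hn s))
        generalize (A * (1 / 2) ^ s) ^ (e + 1) *
          Real.exp (-(B * (1 / 2) ^ s * (n - (e + 1) : ℕ))) = X
        rw [Nat.add_sub_cancel, ENNReal.ofReal_mul (by positivity),
          ENNReal.ofReal_mul (p := (n : ℝ) ^ (e + 1)) (by positivity),
          ENNReal.ofReal_pow (by positivity), ENNReal.ofReal_pow (by positivity),
          ENNReal.ofReal_add (by positivity) (by positivity)]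
        simp only [ENNReal.ofReal_natCast, ENNReal.ofReal_one]
        ring
    _ = ENNReal.ofReal ((N + 1 : ℝ) ^ e) * ∑' s : ℕ,
        ENNReal.ofReal (K * ((Nat.dist s N + 1 : ℝ) ^ e * (1 / 2) ^ Nat.dist s N)) :=
        ENNReal.tsum_mul_left
    _ ≤ ENNReal.ofReal ((N + 1 : ℝ) ^ e) * (2 * ∑' j : ℕ,
        ENNReal.ofReal (K * ((j + 1 : ℝ) ^ e * (1 / 2) ^ j))) := by
        gcongr
        exact tsum_dist_le N fun j => ENNReal.ofReal (K * ((j + 1 : ℝ) ^ e * (1 / 2) ^ j))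
    _ = ENNReal.ofReal ((N + 1 : ℝ) ^ e * (2 * Z)) := by
        rw [← ENNReal.ofReal_tsum_of_nonneg (fun j => by positivity) hsum,
          ENNReal.ofReal_mul (by positivity), ENNReal.ofReal_mul two_pos.le, ENNReal.ofReal_ofNat]
    _ ≤ _ := by
        refine ENNReal.ofReal_le_ofReal ?_
        calc (N + 1 : ℝ) ^ e * (2 * Z) ≤ (4 * Real.log n) ^ e * (2 * Z + 1) := by
              gcongr
              · exact natLog_add_one_le hn2
              · linarith
          _ = _ := by rw [mul_pow]; simp only [Nat.add_sub_cancel]; ring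

end Sums

section Product

open scoped ENNReal

/-- The points indexed by `τ` lie in `D` and the remaining points lie in `C`. -/
def tupleEvent {α : Type*} {d n : ℕ} (τ : Fin d → Fin n) (D : Fin d → Set α) (C : Set α) :
    Set (Fin n → α) :=
  {x | (∀ j, x (τ j) ∈ D j) ∧ ∀ i ∉ Set.range τ, x i ∈ C}

lemma measurableSet_tupleEvent {α : Type*} [MeasurableSpace α] {d n : ℕ} (τ : Fin d → Fin n)
    {D : Fin d → Set α} {C : Set α} (hD : ∀ j, MeasurableSet (D j)) (hC : MeasurableSet C) :
    MeasurableSet (tupleEvent τ D C) := by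
  simp only [tupleEvent, Set.ofPred_and, Set.ofPred_forall]
  refine (MeasurableSet.iInter fun j => (hD j).preimage (measurable_pi_apply _)).inter
    (MeasurableSet.iInter fun i => MeasurableSet.iInter fun _ =>
      hC.preimage (measurable_pi_apply _))

lemma measure_tupleEvent {α : Type*} [MeasurableSpace α] (μ : Measure α) [IsProbabilityMeasure μ]
    {d n : ℕ} {τ : Fin d → Fin n} (hτ : Function.Injective τ) (D : Fin d → Set α) (C : Set α) :
    (Measure.pi fun _ : Fin n => μ) (tupleEvent τ D C) = (∏ j, μ (D j)) * μ C ^ (n - d) := by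
  classical
  have hset : tupleEvent τ D C =
      Set.univ.pi (Function.extend τ D fun _ => C) := by
    ext x
    simp only [tupleEvent, Set.mem_ofPred_eq, Set.mem_univ_pi]
    constructor
    · rintro ⟨h1, h2⟩ i
      by_cases hi : i ∈ Set.range τ
      · obtain ⟨j, rfl⟩ := hi
        rw [hτ.extend_apply]
        exact h1 j
      · rw [Function.extend_apply' _ _ _ (by simpa using hi)]
        exact h2 i hi
    · intro h
      refine ⟨fun j => ?_, fun i hi => ?_⟩
      · simpa [hτ.extend_apply] using h (τ j)
      · simpa [Function.extend_apply' _ _ _ (show ¬∃ a, τ a = i by simpa using hi)] using h i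
  rw [hset, Measure.pi_pi, ← Finset.prod_mul_prod_compl (Finset.univ.image τ),
    Finset.prod_image hτ.injOn]
  congr 1
  · simp [hτ.extend_apply]
  · rw [Finset.prod_eq_pow_card (b := μ C), Finset.card_compl]
    · simp [Finset.card_image_of_injective _ hτ]
    · intro i hi
      rw [Function.extend_apply' _ _ _ (by simpa using hi)]

lemma ae_forall_betaMeasure1_mem_Ioo {d n : ℕ} {β : Fin d → ℝ} (hβ : ∀ i, 0 ≤ β i) :
    ∀ᵐ x ∂(Measure.pi fun _ : Fin n => Measure.pi fun i => betaMeasure1 (β i)),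
      ∀ j i, x j i ∈ Set.Ioo (-1 : ℝ) 1 := by
  have := fun i => isProbabilityMeasure_betaMeasure1 (hβ i)
  rw [ae_all_iff]
  intro j
  have h : ∀ᵐ p ∂(Measure.pi fun i => betaMeasure1 (β i)), ∀ i, p i ∈ Set.Ioo (-1 : ℝ) 1 := by
    rw [ae_all_iff]
    intro i
    exact (measurePreserving_eval (fun i => betaMeasure1 (β i)) i).quasiMeasurePreserving.ae
      ae_betaMeasure1_mem_Ioo
  exact (measurePreserving_eval (fun _ : Fin n => Measure.pi fun i => betaMeasure1 (β i))
    j).quasiMeasurePreserving.ae h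

/-- The box of points whose `i`-th coordinate is at distance at most `r i` from `s i = ± 1`. -/
def cornerBox {d : ℕ} (s r : Fin d → ℝ) : Set (Fin d → ℝ) :=
  {p | ∀ i, 1 - s i * p i ∈ Set.Icc 0 (r i)}

/-- The dyadic shell inside `cornerBox s r`. -/
def cornerShell {d : ℕ} (s r : Fin d → ℝ) : Set (Fin d → ℝ) :=
  {p | ∀ i, 1 - s i * p i ∈ Set.Icc (r i / 2) (r i)}

lemma cornerShell_subset_cornerBox {d : ℕ} {s r : Fin d → ℝ} (hr : ∀ i, 0 ≤ r i) :
    cornerShell s r ⊆ cornerBox s r :=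
  fun _ hp i => ⟨(div_nonneg (hr i) two_pos.le).trans (hp i).1, (hp i).2⟩

lemma measurableSet_cornerBox {d : ℕ} (s r : Fin d → ℝ) : MeasurableSet (cornerBox s r) := by
  simp only [cornerBox, Set.ofPred_forall]
  exact MeasurableSet.iInter fun i => measurableSet_Icc.preimage (by fun_prop)

lemma measurableSet_cornerShell {d : ℕ} (s r : Fin d → ℝ) : MeasurableSet (cornerShell s r) := by
  simp only [cornerShell, Set.ofPred_forall]
  exact MeasurableSet.iInter fun i => measurableSet_Icc.preimage (by fun_prop)

lemma exists_measure_cornerBox_le {d : ℕ} {β : Fin d → ℝ} (hβ : ∀ i, 0 ≤ β i) (θ : Fin d → ℝ)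
    (hθ : ∀ i, 0 < θ i) : ∃ A > 0, ∀ s : Fin d → ℝ, (∀ i, s i = 1 ∨ s i = -1) → ∀ k : Fin d → ℕ,
      (Measure.pi fun i => betaMeasure1 (β i))
        (cornerBox s fun i => θ i * halvingRatio (β i) ^ k i) ≤
      ENNReal.ofReal (A * (1 / 2) ^ ∑ i, k i) := by
  have := fun i => isProbabilityMeasure_betaMeasure1 (hβ i)
  choose A hA hle using fun i => exists_betaMeasure1_le (hβ i) (θ i) (hθ i)
  refine ⟨∏ i, A i, Finset.prod_pos fun i _ => hA i, fun s hs k => ?_⟩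
  have hset : (cornerBox s fun i => θ i * halvingRatio (β i) ^ k i) =
      Set.univ.pi fun i => {t | 1 - s i * t ∈ Set.Icc 0 (θ i * halvingRatio (β i) ^ k i)} := by
    ext p
    simp [cornerBox]
  rw [hset, Measure.pi_pi, ← Finset.prod_pow_eq_pow_sum, ← Finset.prod_mul_distrib,
    ENNReal.ofReal_prod_of_nonneg fun i _ => mul_nonneg (hA i).le (by positivity)]
  exact Finset.prod_le_prod' fun i _ => hle i (s i) (hs i) (k i)

lemma exists_le_measure_cornerShell {d : ℕ} {β : Fin d → ℝ} (hβ : ∀ i, 0 ≤ β i) (θ : Fin d → ℝ)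
    (hθ : ∀ i, 0 < θ i) (hθ1 : ∀ i, θ i ≤ 1) :
    ∃ A > 0, ∀ s : Fin d → ℝ, (∀ i, s i = 1 ∨ s i = -1) → ∀ k : Fin d → ℕ,
      ENNReal.ofReal (A * (1 / 2) ^ ∑ i, k i) ≤
      (Measure.pi fun i => betaMeasure1 (β i))
        (cornerShell s fun i => θ i * halvingRatio (β i) ^ k i) := by
  have := fun i => isProbabilityMeasure_betaMeasure1 (hβ i)
  choose A hA hle using fun i => exists_le_betaMeasure1 (hβ i) (θ i) (hθ i) (hθ1 i)
  refine ⟨∏ i, A i, Finset.prod_pos fun i _ => hA i, fun s hs k => ?_⟩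
  have hset : (cornerShell s fun i => θ i * halvingRatio (β i) ^ k i) =
      Set.univ.pi fun i => {t | 1 - s i * t ∈ Set.Icc (θ i * halvingRatio (β i) ^ k i / 2)
        (θ i * halvingRatio (β i) ^ k i)} := by
    ext p
    simp [cornerShell]
  rw [hset, Measure.pi_pi, ← Finset.prod_pow_eq_pow_sum, ← Finset.prod_mul_distrib,
    ENNReal.ofReal_prod_of_nonneg fun i _ => mul_nonneg (hA i).le (by positivity)]
  exact Finset.prod_le_prod' fun i _ => hle i (s i) (hs i) (k i)

end Product

section UpperBound

open scoped ENNReal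

/-- A facet hyperplane of a polytope in the cube cuts a corner of the cube; up to constants the
corner is a box with dyadic side lengths. -/
lemma exists_cornerBox_of_isFacetTuple {d n : ℕ} (hd : 0 < d) {ρ : Fin d → ℝ}
    (hρ0 : ∀ i, 0 < ρ i) (hρ1 : ∀ i, ρ i < 1) {x : Fin n → Fin d → ℝ}
    (hx : ∀ j i, x j i ∈ Set.Ioo (-1 : ℝ) 1) {τ : Fin d → Fin n} (hτ : IsFacetTuple x τ) :
    ∃ (σ : Fin d → Bool) (k : Fin d → ℕ),
      (∀ j, x (τ j) ∈ cornerBox (fun i => if σ i then 1 else -1) fun i => 2 * ρ i ^ k i) ∧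
      ∀ j, x j ∉ cornerBox (fun i => if σ i then 1 else -1)
        fun i => 1 / d * ρ i * ρ i ^ k i := by
  obtain ⟨u, hu, hsup⟩ := supported_iff_dotProduct.1 hτ.2
  obtain ⟨i₀, hi₀⟩ : ∃ i, u i ≠ 0 := Function.ne_iff.1 hu
  set σ : Fin d → Bool := fun i => decide (0 ≤ u i) with hσ
  set s : Fin d → ℝ := fun i => if σ i then 1 else -1 with hs
  have hus : ∀ i, u i = |u i| * s i := by
    intro i
    rcases le_or_gt 0 (u i) with h | h
    · simp [hs, hσ, h, abs_of_nonneg h]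
    · simp [hs, hσ, h.not_ge, abs_of_neg h]
  have hpos : ∀ j i, 1 - s i * x j i ∈ Set.Ioo (0 : ℝ) 2 := by
    intro j i
    have := hx j i
    simp only [hs, Set.mem_Ioo] at this ⊢
    split_ifs <;> constructor <;> linarith
  set j₀ : Fin n := τ ⟨0, hd⟩ with hj₀
  set t : ℝ := ∑ i, |u i| * (1 - s i * x j₀ i) with ht
  have hdot : ∀ j, ∑ i, |u i| * (1 - s i * x j i) = (∑ i, |u i|) - u ⬝ᵥ x j := by
    intro j
    rw [dotProduct, ← Finset.sum_sub_distrib]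
    refine Finset.sum_congr rfl fun i _ => ?_
    conv_rhs => rw [hus i, abs_mul, abs_abs]
    have : |s i| = 1 := by simp only [hs]; split_ifs <;> simp
    rw [this]
    ring
  have hge : ∀ j, t ≤ ∑ i, |u i| * (1 - s i * x j i) := by
    intro j
    rw [ht, hdot, hdot]
    linarith [hsup j₀ ⟨_, rfl⟩ j]
  have heq : ∀ j, ∑ i, |u i| * (1 - s i * x (τ j) i) = t := by
    intro j
    refine le_antisymm ?_ (hge _)
    rw [ht, hdot, hdot]
    linarith [hsup (τ j) ⟨_, rfl⟩ j₀]
  have hnn : ∀ j i, 0 ≤ |u i| * (1 - s i * x j i) :=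
    fun j i => mul_nonneg (abs_nonneg _) (hpos j i).1.le
  have htpos : 0 < t := by
    refine Finset.sum_pos' (fun i _ => hnn _ i) ⟨i₀, Finset.mem_univ _, ?_⟩
    exact mul_pos (abs_pos.2 hi₀) (hpos _ _).1
  set b : Fin d → ℝ := fun i => if u i = 0 then 2 else min 2 (t / |u i|) with hb
  have hbpos : ∀ i, 0 < b i := by
    intro i
    simp only [hb]
    split_ifs with h
    · exact two_pos
    · exact lt_min two_pos (div_pos htpos (abs_pos.2 h))
  have hb2 : ∀ i, b i ≤ 2 := by
    intro i
    simp only [hb]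
    split_ifs
    · exact le_rfl
    · exact min_le_left _ _
  choose k hk1 hk2 using fun i => exists_nat_pow_near_of_lt_one (x := b i / 2)
    (by linarith [hbpos i]) (by linarith [hb2 i]) (hρ0 i) (hρ1 i)
  refine ⟨σ, k, fun j i => ⟨(hpos _ i).1.le, ?_⟩, fun j hj => ?_⟩
  · have hbi : 1 - s i * x (τ j) i ≤ b i := by
      simp only [hb]
      split_ifs with h
      · exact (hpos _ _).2.le
      · refine le_min (hpos _ _).2.le ?_
        rw [le_div_iff₀ (abs_pos.2 h), mul_comm, ← heq j]
        exact Finset.single_le_sum (f := fun i => |u i| * (1 - s i * x (τ j) i))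
          (fun i _ => hnn _ i) (Finset.mem_univ i)
    change 1 - s i * x (τ j) i ≤ _
    linarith [hk2 i]
  · have hd' : (0 : ℝ) < d := by exact_mod_cast hd
    have hlt : ∀ i, |u i| * (1 - s i * x j i) ≤ t / (2 * d) := by
      intro i
      by_cases h : u i = 0
      · rw [h, abs_zero, zero_mul]
        positivity
      have h1 : 1 - s i * x j i ≤ 1 / d * ρ i * ρ i ^ k i := (hj i).2
      have h2 : ρ i * ρ i ^ k i < b i / 2 := by rw [← pow_succ']; exact hk1 i
      have h3 : b i ≤ t / |u i| := by
        simp only [hb, if_neg h]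
        exact min_le_right _ _
      rw [le_div_iff₀ (abs_pos.2 h)] at h3
      calc |u i| * (1 - s i * x j i) ≤ |u i| * (1 / d * (b i / 2)) := by
            gcongr
            calc _ ≤ _ := h1
              _ = 1 / d * (ρ i * ρ i ^ k i) := by ring
              _ ≤ _ := by gcongr
        _ = b i * |u i| / (2 * d) := by ring
        _ ≤ _ := by gcongr
    have := (hge j).trans (Finset.sum_le_sum fun i _ => hlt i)
    rw [Finset.sum_const, Finset.card_univ, Fintype.card_fin, nsmul_eq_mul] at this
    have h2 : (d : ℝ) * (t / (2 * d)) = t / 2 := by field_simp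
    linarith

lemma exists_lintegral_faceCount_le {d : ℕ} (hd : 0 < d) {β : Fin d → ℝ} (hβ : ∀ i, 0 ≤ β i) :
    ∃ C > 0, ∀ n : ℕ, 2 * d ≤ n →
      ∫⁻ x : Fin n → Fin d → ℝ, (faceCount (convexHull ℝ (Set.range x)) (d - 1) : ℝ≥0∞)
        ∂(Measure.pi fun _ : Fin n => Measure.pi fun i => betaMeasure1 (β i)) ≤
      ENNReal.ofReal (C * Real.log n ^ (d - 1)) := by
  classical
  have := fun i => isProbabilityMeasure_betaMeasure1 (hβ i)
  have hd' : (0 : ℝ) < d := by exact_mod_cast hd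
  have hd1 : 1 / (d : ℝ) ≤ 1 := by
    rw [div_le_one hd']
    exact_mod_cast hd
  set ρ : Fin d → ℝ := fun i => halvingRatio (β i) with hρ
  have hρ0 : ∀ i, 0 < ρ i := fun i => halvingRatio_pos (β i)
  have hρ1 : ∀ i, ρ i < 1 := fun i => halvingRatio_lt_one (hβ i)
  set μ : Measure (Fin d → ℝ) := Measure.pi fun i => betaMeasure1 (β i) with hμ
  set s : (Fin d → Bool) → Fin d → ℝ := fun σ i => if σ i then 1 else -1 with hs
  have hs1 : ∀ σ i, s σ i = 1 ∨ s σ i = -1 := fun σ i => by simp only [hs]; split_ifs <;> simp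
  set outer : (Fin d → Bool) → (Fin d → ℕ) → Set (Fin d → ℝ) :=
    fun σ k => cornerBox (s σ) fun i => 2 * ρ i ^ k i with houter
  set inner : (Fin d → Bool) → (Fin d → ℕ) → Set (Fin d → ℝ) :=
    fun σ k => cornerBox (s σ) fun i => 1 / d * ρ i * ρ i ^ k i with hinner
  obtain ⟨A, hA, hAle⟩ := exists_measure_cornerBox_le hβ (fun _ => 2) fun _ => two_pos
  obtain ⟨B, hB, hBle⟩ := exists_le_measure_cornerShell hβ (fun i => 1 / d * ρ i)
    (fun i => mul_pos (by positivity) (hρ0 i))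
    (fun i => mul_le_one₀ hd1 (hρ0 i).le (hρ1 i).le)
  obtain ⟨C, hC, hCle⟩ := exists_tsum_scale_le hd hA hB
  refine ⟨2 ^ d * C, by positivity, fun n hn => ?_⟩
  set G : (Fin d → Fin n) → (Fin d → Bool) → (Fin d → ℕ) → Set (Fin n → Fin d → ℝ) :=
    fun τ σ k => if Function.Injective τ then tupleEvent τ (fun _ => outer σ k) (inner σ k)ᶜ
      else ∅ with hG
  have hGm : ∀ τ σ k, MeasurableSet (G τ σ k) := by
    intro τ σ k
    simp only [hG]
    split_ifs
    · exact measurableSet_tupleEvent τ (fun _ => measurableSet_cornerBox _ _)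
        (measurableSet_cornerBox _ _).compl
    · exact MeasurableSet.empty
  have hGle : ∀ τ σ k, (Measure.pi fun _ : Fin n => μ) (G τ σ k) ≤
      ENNReal.ofReal ((A * (1 / 2) ^ ∑ i, k i) ^ d *
        Real.exp (-(B * (1 / 2) ^ (∑ i, k i) * (n - d : ℕ)))) := by
    intro τ σ k
    simp only [hG]
    split_ifs with hτ
    · rw [measure_tupleEvent μ hτ, Finset.prod_const, Finset.card_univ, Fintype.card_fin,
        ENNReal.ofReal_mul (by positivity), ENNReal.ofReal_pow (by positivity)]
      refine mul_le_mul' (pow_le_pow_left' (hAle (s σ) (hs1 σ) k) d) ?_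
      have h1 : ENNReal.ofReal (B * (1 / 2) ^ ∑ i, k i) ≤ μ (inner σ k) :=
        (hBle (s σ) (hs1 σ) k).trans (measure_mono (cornerShell_subset_cornerBox fun i =>
          mul_nonneg (mul_nonneg (by positivity) (hρ0 i).le) (pow_nonneg (hρ0 i).le _)))
      calc μ (inner σ k)ᶜ ^ (n - d)
          ≤ ENNReal.ofReal (Real.exp (-(B * (1 / 2) ^ ∑ i, k i))) ^ (n - d) := by
            refine pow_le_pow_left' ?_ _
            rw [prob_compl_eq_one_sub (measurableSet_cornerBox _ _)]
            calc _ ≤ 1 - ENNReal.ofReal (B * (1 / 2) ^ ∑ i, k i) := tsub_le_tsub_left h1 _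
              _ = ENNReal.ofReal (1 - B * (1 / 2) ^ ∑ i, k i) := by
                  rw [ENNReal.ofReal_sub _ (by positivity), ENNReal.ofReal_one]
              _ ≤ _ := ENNReal.ofReal_le_ofReal (Real.one_sub_le_exp_neg _)
        _ = _ := by
            rw [← ENNReal.ofReal_pow (Real.exp_pos _).le, ← Real.exp_nat_mul]
            congr 2
            ring
    · simp
  have hpt : ∀ᵐ x ∂(Measure.pi fun _ : Fin n => μ),
      (faceCount (convexHull ℝ (Set.range x)) (d - 1) : ℝ≥0∞) ≤
        ∑ τ, ∑ σ, ∑' k, (G τ σ k).indicator 1 x := by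
    filter_upwards [ae_forall_betaMeasure1_mem_Ioo hβ] with x hx
    calc (faceCount (convexHull ℝ (Set.range x)) (d - 1) : ℝ≥0∞)
        ≤ ((Finset.univ.filter fun τ : Fin d → Fin n => IsFacetTuple x τ).card : ℝ≥0∞) := by
          exact_mod_cast faceCount_le_card (by simp) hd x
      _ = ∑ τ : Fin d → Fin n, if IsFacetTuple x τ then 1 else 0 := by
          rw [Finset.sum_boole]
      _ ≤ _ := by
          refine Finset.sum_le_sum fun τ _ => ?_
          split_ifs with hτ
          · obtain ⟨σ, k, h1, h2⟩ := exists_cornerBox_of_isFacetTuple hd hρ0 hρ1 hx hτ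
            have hinj : Function.Injective τ := hτ.1.injective.of_comp
            have hmem : x ∈ G τ σ k := by
              simp only [hG, if_pos hinj]
              exact ⟨h1, fun i _ => h2 i⟩
            calc (1 : ℝ≥0∞) = (G τ σ k).indicator 1 x := by
                  rw [Set.indicator_of_mem hmem, Pi.one_apply]
              _ ≤ ∑' k, (G τ σ k).indicator 1 x := ENNReal.le_tsum k
              _ ≤ _ := Finset.single_le_sum
                  (f := fun σ => ∑' k, (G τ σ k).indicator (1 : (Fin n → Fin d → ℝ) → ℝ≥0∞) x)
                  (fun _ _ => zero_le) (Finset.mem_univ σ)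
          · exact zero_le
  calc _ ≤ ∫⁻ x, ∑ τ, ∑ σ, ∑' k, (G τ σ k).indicator 1 x ∂(Measure.pi fun _ : Fin n => μ) :=
        lintegral_mono_ae hpt
    _ = ∑ τ, ∑ σ, ∑' k, (Measure.pi fun _ : Fin n => μ) (G τ σ k) := by
        have hm : ∀ τ σ k, Measurable ((G τ σ k).indicator (1 : (Fin n → Fin d → ℝ) → ℝ≥0∞)) :=
          fun τ σ k => measurable_one.indicator (hGm τ σ k)
        rw [lintegral_finsetSum _ fun τ _ => Finset.measurable_fun_sum _ fun σ _ =>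
          Measurable.tsum fun k => hm τ σ k]
        refine Finset.sum_congr rfl fun τ _ => ?_
        rw [lintegral_finsetSum _ fun σ _ => Measurable.tsum fun k => hm τ σ k]
        refine Finset.sum_congr rfl fun σ _ => ?_
        rw [lintegral_tsum fun k => (hm τ σ k).aemeasurable]
        exact tsum_congr fun k => lintegral_indicator_one (hGm τ σ k)
    _ ≤ ∑ _τ : Fin d → Fin n, ∑ _σ : Fin d → Bool, ∑' k : Fin d → ℕ,
        ENNReal.ofReal ((A * (1 / 2) ^ ∑ i, k i) ^ d *
          Real.exp (-(B * (1 / 2) ^ (∑ i, k i) * (n - d : ℕ)))) :=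
        Finset.sum_le_sum fun τ _ => Finset.sum_le_sum fun σ _ =>
          ENNReal.tsum_le_tsum fun k => hGle τ σ k
    _ = 2 ^ d * ((n : ℝ≥0∞) ^ d * ∑' k : Fin d → ℕ,
        ENNReal.ofReal ((A * (1 / 2) ^ ∑ i, k i) ^ d *
          Real.exp (-(B * (1 / 2) ^ (∑ i, k i) * (n - d : ℕ))))) := by
        simp only [Finset.sum_const, Finset.card_univ, Fintype.card_pi, Fintype.card_fin,
          Fintype.card_bool, Finset.prod_const, nsmul_eq_mul]
        push_cast
        ring
    _ ≤ 2 ^ d * ENNReal.ofReal (C * Real.log n ^ (d - 1)) := by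
        gcongr
        exact hCle n hn
    _ = _ := by
        rw [mul_assoc (2 ^ d : ℝ), ENNReal.ofReal_mul (p := (2 : ℝ) ^ d) (by positivity),
          ENNReal.ofReal_pow two_pos.le, ENNReal.ofReal_ofNat]

end UpperBound

section CornerTuple

variable {d n : ℕ}

lemma exists_mulVec_eq_one (hd : 0 < d) {Y : Matrix (Fin d) (Fin d) ℝ}
    (hdiag : ∀ i, Y i i ∈ Set.Icc (1 / 2 : ℝ) 1)
    (hoff : ∀ j i, i ≠ j → Y j i ∈ Set.Icc 0 (1 / (8 * d : ℝ))) :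
    Y.det ≠ 0 ∧ ∃ l : Fin d → ℝ, Y.mulVec l = 1 ∧ ∀ i, 2 / 3 ≤ l i := by
  have hd' : (0 : ℝ) < d := by exact_mod_cast hd
  have hcard : ∀ j : Fin d, ((Finset.univ.erase j).card : ℝ) ≤ d := by
    intro j
    exact_mod_cast (Finset.card_le_univ _).trans (by simp)
  have hsum : ∀ j, ∀ c : Fin d → ℝ, ∀ m, 0 ≤ m → (∀ i, |c i| ≤ m) →
      |∑ i ∈ Finset.univ.erase j, Y j i * c i| ≤ m / 8 := by
    intro j c m hm hc
    calc _ ≤ ∑ i ∈ Finset.univ.erase j, |Y j i * c i| := Finset.abs_sum_le_sum_abs _ _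
      _ ≤ ∑ i ∈ Finset.univ.erase j, 1 / (8 * d) * m := by
          refine Finset.sum_le_sum fun i hi => ?_
          have h := hoff j i (Finset.ne_of_mem_erase hi)
          rw [abs_mul, abs_of_nonneg h.1]
          exact mul_le_mul h.2 (hc i) (abs_nonneg _) (by positivity)
      _ ≤ d * (1 / (8 * d) * m) := by
          rw [Finset.sum_const, nsmul_eq_mul]
          exact mul_le_mul_of_nonneg_right (hcard j) (by positivity)
      _ = m / 8 := by field_simp
  have hdet : Y.det ≠ 0 := by
    refine det_ne_zero_of_sum_row_lt_diag fun j => ?_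
    have h1 := hsum j (fun _ => 1) 1 zero_le_one (by simp)
    have h2 : ∑ i ∈ Finset.univ.erase j, ‖Y j i‖ = ∑ i ∈ Finset.univ.erase j, Y j i * 1 :=
      Finset.sum_congr rfl fun i hi => by
        rw [mul_one, Real.norm_of_nonneg (hoff j i (Finset.ne_of_mem_erase hi)).1]
    rw [h2, Real.norm_of_nonneg (by linarith [(hdiag j).1])]
    linarith [(abs_le.1 h1).2, (hdiag j).1]
  refine ⟨hdet, Y⁻¹.mulVec 1, ?_, ?_⟩
  · rw [Matrix.mulVec_mulVec, Matrix.mul_nonsing_inv _ (isUnit_iff_ne_zero.2 hdet),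
      Matrix.one_mulVec]
  set l := Y⁻¹.mulVec 1 with hl
  have hYl : ∀ j, Y j j * l j + ∑ i ∈ Finset.univ.erase j, Y j i * l i = 1 := by
    intro j
    have h : Y.mulVec l = 1 := by
      rw [hl, Matrix.mulVec_mulVec, Matrix.mul_nonsing_inv _ (isUnit_iff_ne_zero.2 hdet),
        Matrix.one_mulVec]
    have := congrFun h j
    rw [Matrix.mulVec, dotProduct, ← Finset.add_sum_erase _ _ (Finset.mem_univ j)] at this
    exact this
  have : Nonempty (Fin d) := ⟨⟨0, hd⟩⟩
  obtain ⟨i₀, -, hi₀⟩ := Finset.exists_max_image Finset.univ (fun i => |l i|)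
    Finset.univ_nonempty
  have hmax : |l i₀| ≤ 8 / 3 := by
    have h1 := hsum i₀ l |l i₀| (abs_nonneg _) fun i => hi₀ i (Finset.mem_univ i)
    have h2 := hYl i₀
    have h3 : |Y i₀ i₀ * l i₀| ≤ 1 + |l i₀| / 8 := by
      rw [eq_sub_of_add_eq h2]
      calc _ ≤ |(1 : ℝ)| + |∑ i ∈ Finset.univ.erase i₀, Y i₀ i * l i| := abs_sub _ _
        _ ≤ _ := by rw [abs_one]; gcongr
    rw [abs_mul, abs_of_nonneg (by linarith [(hdiag i₀).1])] at h3
    nlinarith [(hdiag i₀).1, abs_nonneg (l i₀)]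
  intro j
  have h1 := hsum j l (8 / 3) (by norm_num) fun i => (hi₀ i (Finset.mem_univ i)).trans hmax
  have h2 := hYl j
  have h3 : 2 / 3 ≤ Y j j * l j := by linarith [(abs_le.1 h1).2]
  have h4 : 0 < l j := by
    by_contra! hneg
    nlinarith [(hdiag j).1]
  nlinarith [(hdiag j).2]

/-- The relative size of the `i`-th side of the box containing the `j`-th vertex. -/
def vertexRatio (d : ℕ) (j i : Fin d) : ℝ :=
  if i = j then 1 else 1 / (8 * d)

lemma vertexRatio_pos (hd : 0 < d) (j i : Fin d) : 0 < vertexRatio d j i := by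
  have hd' : (0 : ℝ) < d := by exact_mod_cast hd
  unfold vertexRatio
  split_ifs <;> positivity

lemma vertexRatio_le_one (j i : Fin d) : vertexRatio d j i ≤ 1 := by
  unfold vertexRatio
  split_ifs
  · exact le_rfl
  · have h1 : (1 : ℝ) ≤ d := by exact_mod_cast j.pos
    rw [div_le_one (by linarith)]
    linarith

/-- The points `x (τ j)` lie close to the corner `(1, …, 1)`, on the scale `a`, and the remaining
points do not. -/
def cornerTupleEvent (a : Fin d → ℝ) (τ : Fin d → Fin n) : Set (Fin n → Fin d → ℝ) :=
  tupleEvent τ (fun j => cornerShell (fun _ => 1) fun i => vertexRatio d j i * a i)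
    (cornerBox (fun _ => 1) fun i => 2 * a i)ᶜ

lemma measurableSet_cornerTupleEvent (a : Fin d → ℝ) (τ : Fin d → Fin n) :
    MeasurableSet (cornerTupleEvent a τ) :=
  measurableSet_tupleEvent τ (fun _ => measurableSet_cornerShell _ _)
    (measurableSet_cornerBox _ _).compl

variable {x : Fin n → Fin d → ℝ} {a : Fin d → ℝ} {τ : Fin d → Fin n}

lemma cornerTupleEvent_coord (hx : x ∈ cornerTupleEvent a τ) (j i : Fin d) :
    1 - x (τ j) i ∈ Set.Icc (vertexRatio d j i * a i / 2) (vertexRatio d j i * a i) := by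
  have h := hx.1 j i
  rwa [one_mul] at h

lemma isFacetTuple_of_mem_cornerTupleEvent (hd : 0 < d) (ha : ∀ i, 0 < a i)
    (hcube : ∀ j i, x j i ∈ Set.Ioo (-1 : ℝ) 1) (hx : x ∈ cornerTupleEvent a τ) :
    IsFacetTuple x τ ∧ ∀ p ∈ tupleFace x τ, ∀ i, 1 - p i ≤ 3 / 2 * a i := by
  have hd' : (0 : ℝ) < d := by exact_mod_cast hd
  set Y : Matrix (Fin d) (Fin d) ℝ := fun j i => (1 - x (τ j) i) / a i with hY
  have hYmem : ∀ j i, Y j i ∈ Set.Icc (vertexRatio d j i / 2) (vertexRatio d j i) := by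
    intro j i
    have h := cornerTupleEvent_coord hx j i
    constructor
    · rw [hY, le_div_iff₀ (ha i)]
      linarith [h.1]
    · rw [hY, div_le_iff₀ (ha i)]
      exact h.2
  obtain ⟨hdet, l, hl, hl23⟩ := exists_mulVec_eq_one hd (Y := Y)
    (fun i => by simpa [vertexRatio] using hYmem i i)
    (fun j i hij => by
      have h := hYmem j i
      have h2 := vertexRatio_pos hd j i
      refine ⟨by linarith [h.1], h.2.trans_eq ?_⟩
      rw [vertexRatio, if_neg hij])
  set u : Fin d → ℝ := fun i => l i / a i with hu
  have hupos : ∀ i, 0 < u i := fun i => div_pos (by linarith [hl23 i]) (ha i)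
  have hua : ∀ i, 2 / 3 ≤ u i * a i := by
    intro i
    rw [hu, div_mul_cancel₀ _ (ha i).ne']
    exact hl23 i
  have hdot : ∀ p : Fin d → ℝ, u ⬝ᵥ p = (∑ i, u i) - ∑ i, u i * (1 - p i) := by
    intro p
    rw [dotProduct, ← Finset.sum_sub_distrib]
    exact Finset.sum_congr rfl fun i _ => by ring
  have hτ1 : ∀ j, ∑ i, u i * (1 - x (τ j) i) = 1 := by
    intro j
    have h := congrFun hl j
    rw [Matrix.mulVec, dotProduct, Pi.one_apply] at h
    refine Eq.trans ?_ h
    refine Finset.sum_congr rfl fun i _ => ?_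
    rw [hu, hY]
    ring
  have hnn : ∀ j i, 0 ≤ u i * (1 - x j i) :=
    fun j i => mul_nonneg (hupos i).le (by linarith [(hcube j i).2])
  have hge : ∀ j, 1 ≤ ∑ i, u i * (1 - x j i) := by
    intro j
    by_cases hj : j ∈ Set.range τ
    · obtain ⟨j, rfl⟩ := hj
      exact (hτ1 j).ge
    · have h := hx.2 j hj
      simp only [cornerBox, Set.mem_compl_iff, Set.mem_ofPred_eq, one_mul, Set.mem_Icc,
        not_forall, not_and, not_le] at h
      obtain ⟨i, hi⟩ := h
      have hi := hi (by linarith [(hcube j i).2])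
      calc (1 : ℝ) ≤ 2 * (u i * a i) := by linarith [hua i]
        _ = u i * (2 * a i) := by ring
        _ ≤ u i * (1 - x j i) := mul_le_mul_of_nonneg_left hi.le (hupos i).le
        _ ≤ _ := Finset.single_le_sum (f := fun i => u i * (1 - x j i)) (fun i _ => hnn j i)
            (Finset.mem_univ i)
  have hu0 : u ≠ 0 := fun h => (hupos ⟨0, hd⟩).ne' (congrFun h _)
  have hAI : AffineIndependent ℝ (x ∘ τ) := by
    rw [affineIndependent_iff_of_fintype]
    intro w hw0 hw
    rw [Finset.weightedVSub_eq_linear_combination _ hw0] at hw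
    refine congrFun (Matrix.eq_zero_of_vecMul_eq_zero hdet ?_)
    funext i
    have h := congrFun hw i
    simp only [Finset.sum_apply, Pi.smul_apply, Function.comp_apply, smul_eq_mul,
      Pi.zero_apply] at h
    calc ∑ j, w j * Y j i = (∑ j, w j - ∑ j, w j * x (τ j) i) / a i := by
          rw [← Finset.sum_sub_distrib, Finset.sum_div]
          refine Finset.sum_congr rfl fun j _ => ?_
          rw [hY]
          ring
      _ = 0 := by rw [hw0, h, sub_zero, zero_div]
  have hfacet : IsFacetTuple x τ := by
    refine ⟨hAI, supported_iff_dotProduct.2 ⟨u, hu0, ?_⟩⟩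
    rintro _ ⟨j, rfl⟩ j'
    rw [hdot, hdot, hτ1]
    linarith [hge j']
  refine ⟨hfacet, fun p hp i => ?_⟩
  have hf0 : (dotProductBilin ℝ ℝ u : Module.Dual ℝ (Fin d → ℝ)) ≠ 0 := fun h0 => hu0 <| by
    funext i
    have := LinearMap.congr_fun h0 (Pi.single i 1)
    simpa [dotProductBilin] using this
  have hval : ∀ j, (dotProductBilin ℝ ℝ u : Module.Dual ℝ (Fin d → ℝ)) ((x ∘ τ) j) =
      (∑ i, u i) - 1 := fun j => by
    rw [← hτ1 j]
    exact hdot _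
  have hpu : u ⬝ᵥ p = (∑ i, u i) - 1 := by
    have h := (mem_affineSpan_iff_of_affineIndependent (by simp) hAI hf0
      (fun i j => by rw [hval, hval]) ⟨0, hd⟩ p).1 hp.2
    rw [hval] at h
    exact h
  have hple : ∀ i, 0 ≤ u i * (1 - p i) := by
    intro i
    refine mul_nonneg (hupos i).le (sub_nonneg.2 ?_)
    have hsub : convexHull ℝ (Set.range x) ⊆ {p | p i ≤ 1} := by
      refine convexHull_min ?_ (convex_halfSpace_le (LinearMap.proj i).isLinear 1)
      rintro _ ⟨j, rfl⟩
      exact (hcube j i).2.le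
    exact hsub hp.1
  have hpi : u i * (1 - p i) ≤ 1 := by
    have h1 := Finset.single_le_sum (f := fun i => u i * (1 - p i)) (fun i _ => hple i)
      (Finset.mem_univ i)
    have h2 := hdot p
    linarith
  by_contra! hlt
  nlinarith [hupos i, hua i]

lemma cornerTupleEvent_injOn (hd : 0 < d) {r : Fin d → ℝ} (hr0 : ∀ i, 0 < r i)
    (hr1 : ∀ i, r i < 1 / 3) (hcube : ∀ j i, x j i ∈ Set.Ioo (-1 : ℝ) 1)
    {k k' : Fin d → ℕ} {τ τ' : Fin d → Fin n} (hx : x ∈ cornerTupleEvent (fun i => r i ^ k i) τ)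
    (hx' : x ∈ cornerTupleEvent (fun i => r i ^ k' i) τ')
    (hface : tupleFace x τ = tupleFace x τ') : k = k' ∧ τ = τ' := by
  have hd' : (0 : ℝ) < d := by exact_mod_cast hd
  have key : ∀ {k k' : Fin d → ℕ} {τ τ' : Fin d → Fin n},
      x ∈ cornerTupleEvent (fun i => r i ^ k i) τ →
      x ∈ cornerTupleEvent (fun i => r i ^ k' i) τ' →
      tupleFace x τ = tupleFace x τ' → ∀ i, k' i ≤ k i := by
    intro k k' τ τ' hx hx' hface i
    have hmem : x (τ i) ∈ tupleFace x τ :=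
      ⟨subset_convexHull ℝ _ ⟨_, rfl⟩, subset_affineSpan ℝ _ ⟨i, rfl⟩⟩
    rw [hface] at hmem
    have h1 := (isFacetTuple_of_mem_cornerTupleEvent hd (fun i => pow_pos (hr0 i) _) hcube hx').2
      _ hmem i
    have h2 := (cornerTupleEvent_coord hx i i).1
    simp only [vertexRatio, if_true, one_mul] at h2
    by_contra! hlt
    have h3 : r i ^ k' i ≤ r i ^ (k i + 1) :=
      pow_le_pow_of_le_one (hr0 i).le (by linarith [hr1 i]) hlt
    rw [pow_succ] at h3
    nlinarith [hr1 i, pow_pos (hr0 i) (k i)]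
  have hk : k = k' := funext fun i => le_antisymm (key hx' hx hface.symm i) (key hx hx' hface i)
  subst hk
  refine ⟨rfl, funext fun j => ?_⟩
  have hj : τ j ∈ Set.range τ' := by
    by_contra hj
    refine hx'.2 _ hj fun i => ?_
    have h := cornerTupleEvent_coord hx j i
    have h1 := vertexRatio_pos hd j i
    have h2 := vertexRatio_le_one j i
    have h3 := pow_pos (hr0 i) (k i)
    rw [one_mul]
    exact ⟨le_trans (by positivity) h.1, h.2.trans (by nlinarith)⟩
  obtain ⟨j', hj'⟩ := hj
  rcases eq_or_ne j j' with rfl | hne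
  · exact hj'.symm
  · exfalso
    have h1 := (cornerTupleEvent_coord hx j j).1
    have h2 := (cornerTupleEvent_coord hx' j' j).2
    rw [hj'] at h2
    have h4 : vertexRatio d j' j < 1 / 2 := by
      rw [vertexRatio, if_neg hne]
      have : (1 : ℝ) ≤ d := by exact_mod_cast hd
      rw [div_lt_div_iff₀ (by linarith) two_pos]
      linarith
    have h5 : vertexRatio d j j = 1 := by rw [vertexRatio, if_pos rfl]
    rw [h5] at h1
    nlinarith [pow_pos (hr0 j) (k j)]

end CornerTuple

section LowerBound

open scoped ENNReal

lemma exists_finset_sum_eq {d : ℕ} (hd : 0 < d) (L : ℕ) :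
    ∃ S : Finset (Fin d → ℕ), (∀ k ∈ S, ∑ i, k i = L) ∧ ((L : ℝ) / d) ^ (d - 1) ≤ S.card := by
  classical
  obtain ⟨e, rfl⟩ : ∃ e, d = e + 1 := ⟨d - 1, by omega⟩
  set q := L / (e + 1) with hq
  set T : Finset (Fin e → ℕ) := Fintype.piFinset fun _ => Finset.range (q + 1) with hT
  have hTle : ∀ f ∈ T, ∑ i, f i ≤ L := by
    intro f hf
    have hf := fun i => Finset.mem_range.1 (Fintype.mem_piFinset.1 hf i)
    calc ∑ i, f i ≤ ∑ _i : Fin e, q := Finset.sum_le_sum fun i _ => Nat.lt_succ_iff.1 (hf i)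
      _ = e * q := by simp
      _ ≤ (e + 1) * q := by gcongr; omega
      _ ≤ L := Nat.mul_div_le L (e + 1)
  refine ⟨T.image fun f => Fin.cons (L - ∑ i, f i) f, ?_, ?_⟩
  · intro k hk
    obtain ⟨f, hf, rfl⟩ := Finset.mem_image.1 hk
    rw [Fin.sum_univ_succ]
    simp only [Fin.cons_zero, Fin.cons_succ]
    exact Nat.sub_add_cancel (hTle f hf)
  · rw [Finset.card_image_of_injective _ fun f g h => (Fin.cons_injective2 h).2, hT,
      Fintype.card_piFinset]
    simp only [Finset.card_range, Finset.prod_const, Finset.card_univ, Fintype.card_fin,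
      Nat.add_sub_cancel]
    rw [Nat.cast_pow]
    gcongr
    rw [div_le_iff₀ (by positivity)]
    have h : L < (q + 1) * (e + 1) := by
      rw [hq, Nat.mul_comm]
      exact Nat.lt_mul_div_succ L (by omega)
    exact_mod_cast h.le

lemma half_pow_le_card_embedding {d n : ℕ} (hn : 2 * d ≤ n) :
    ((n : ℝ) / 2) ^ d ≤ Fintype.card (Fin d ↪ Fin n) := by
  rw [Fintype.card_embedding_eq, Fintype.card_fin, Fintype.card_fin]
  have h : (n : ℝ) / 2 ≤ (n + 1 - d : ℕ) := by
    rw [Nat.cast_sub (by omega)]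
    push_cast
    have : (2 * d : ℝ) ≤ n := by exact_mod_cast hn
    linarith
  calc ((n : ℝ) / 2) ^ d ≤ ((n + 1 - d : ℕ) : ℝ) ^ d := by gcongr
    _ ≤ _ := by exact_mod_cast Nat.pow_sub_le_descFactorial n d

lemma exists_le_measure_cornerTupleEvent {d : ℕ} {β : Fin d → ℝ} (hd : 0 < d)
    (hβ : ∀ i, 0 ≤ β i) :
    ∃ A > (0 : ℝ), ∃ B > (0 : ℝ), ∀ (k : Fin d → ℕ) (n : ℕ), d ≤ n → 2 * B * n ≤ 2 ^ ∑ i, k i →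
      ∀ τ : Fin d ↪ Fin n, ENNReal.ofReal (A * ((1 / 2) ^ ∑ i, k i) ^ d) ≤
        (Measure.pi fun _ : Fin n => Measure.pi fun i => betaMeasure1 (β i))
          (cornerTupleEvent (fun i => halvingRatio (β i) ^ k i) τ) := by
  have := fun i => isProbabilityMeasure_betaMeasure1 (hβ i)
  choose A hA hAle using fun j => exists_le_measure_cornerShell hβ (vertexRatio d j)
    (vertexRatio_pos hd j) (vertexRatio_le_one j)
  obtain ⟨B, hB, hBle⟩ := exists_measure_cornerBox_le hβ (fun _ => 2) fun _ => two_pos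
  refine ⟨(∏ j, A j) * (1 / 2), mul_pos (Finset.prod_pos fun j _ => hA j) (by norm_num), B, hB,
    fun k n hn hk τ => ?_⟩
  have hprod : 0 ≤ ∏ j, A j := (Finset.prod_pos fun j _ => hA j).le
  set q : ℝ := (1 / 2) ^ ∑ i, k i with hq
  have hq0 : 0 < q := by positivity
  have hBq : n * (B * q) ≤ 1 / 2 := by
    rw [hq, one_div_pow, mul_one_div, mul_div_assoc', div_le_iff₀ (by positivity)]
    linarith
  have hn1 : (1 : ℝ) ≤ n := by exact_mod_cast (by omega : 1 ≤ n)
  have hBq1 : B * q ≤ 1 / 2 := by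
    have : 0 < B * q := by positivity
    nlinarith
  rw [cornerTupleEvent, measure_tupleEvent _ τ.injective]
  calc _ = (∏ j, ENNReal.ofReal (A j * q)) * ENNReal.ofReal (1 / 2) := by
        rw [← ENNReal.ofReal_prod_of_nonneg fun j _ => mul_nonneg (hA j).le hq0.le,
          ← ENNReal.ofReal_mul (Finset.prod_nonneg fun j _ => mul_nonneg (hA j).le hq0.le),
          Finset.prod_mul_distrib, Finset.prod_const, Finset.card_univ, Fintype.card_fin]
        congr 1
        ring
    _ ≤ _ := by
        refine mul_le_mul' (Finset.prod_le_prod' fun j _ => ?_) ?_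
        · exact hAle j (fun _ => 1) (fun _ => Or.inl rfl) k
        · rw [prob_compl_eq_one_sub (measurableSet_cornerBox _ _)]
          calc ENNReal.ofReal (1 / 2) ≤ ENNReal.ofReal ((1 - B * q) ^ (n - d)) := by
                refine ENNReal.ofReal_le_ofReal ?_
                have h := one_add_mul_le_pow (a := -(B * q)) (by linarith) (n - d)
                have h2 : ((n - d : ℕ) : ℝ) ≤ n := by exact_mod_cast Nat.sub_le n d
                have h3 : 0 < B * q := by positivity
                rw [← sub_eq_add_neg] at h
                nlinarith
            _ = (1 - ENNReal.ofReal (B * q)) ^ (n - d) := by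
                rw [ENNReal.ofReal_pow (by linarith), ENNReal.ofReal_sub _ (by positivity),
                  ENNReal.ofReal_one]
            _ ≤ _ := pow_le_pow_left'
                (tsub_le_tsub_left (hBle (fun _ => 1) (fun _ => Or.inl rfl) k) _) _

lemma sum_measure_cornerTupleEvent_le {d n : ℕ} {β : Fin d → ℝ} (hd : 0 < d)
    (hβ : ∀ i, 0 ≤ β i) {r : Fin d → ℝ} (hr0 : ∀ i, 0 < r i) (hr1 : ∀ i, r i < 1 / 3)
    (S : Finset (Fin d → ℕ)) :
    ∑ k ∈ S, ∑ τ : Fin d ↪ Fin n,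
      (Measure.pi fun _ : Fin n => Measure.pi fun i => betaMeasure1 (β i))
        (cornerTupleEvent (fun i => r i ^ k i) τ) ≤
      ∫⁻ x : Fin n → Fin d → ℝ, (faceCount (convexHull ℝ (Set.range x)) (d - 1) : ℝ≥0∞)
        ∂(Measure.pi fun _ : Fin n => Measure.pi fun i => betaMeasure1 (β i)) := by
  classical
  set G : (Fin d → ℕ) × (Fin d ↪ Fin n) → Set (Fin n → Fin d → ℝ) :=
    fun p => cornerTupleEvent (fun i => r i ^ p.1 i) p.2 with hG
  have hGm : ∀ p, MeasurableSet (G p) := fun p => measurableSet_cornerTupleEvent _ _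
  rw [← Finset.sum_product' S Finset.univ fun k τ =>
    (Measure.pi fun _ : Fin n => Measure.pi fun i => betaMeasure1 (β i)) (G (k, τ))]
  calc _ = ∫⁻ x, ∑ p ∈ S ×ˢ Finset.univ, (G p).indicator 1 x
        ∂(Measure.pi fun _ : Fin n => Measure.pi fun i => betaMeasure1 (β i)) := by
        rw [lintegral_finsetSum _ fun p _ => measurable_one.indicator (hGm p)]
        exact Finset.sum_congr rfl fun p _ => (lintegral_indicator_one (hGm p)).symm
    _ ≤ _ := by
        refine lintegral_mono_ae ?_
        filter_upwards [ae_forall_betaMeasure1_mem_Ioo hβ] with x hx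
        calc ∑ p ∈ S ×ˢ Finset.univ, (G p).indicator (1 : (Fin n → Fin d → ℝ) → ℝ≥0∞) x
            = (((S ×ˢ Finset.univ).filter fun p => x ∈ G p).card : ℝ≥0∞) := by
              rw [← Finset.sum_boole]
              rfl
          _ ≤ _ := by
              refine Nat.cast_le.2 (card_le_faceCount (by simp) hd x _ (fun p => p.2) ?_ ?_)
              · intro p hp
                exact (isFacetTuple_of_mem_cornerTupleEvent hd (fun i => pow_pos (hr0 i) _) hx
                  (Finset.mem_filter.1 hp).2).1
              · intro p hp p' hp' hface
                have h := cornerTupleEvent_injOn hd hr0 hr1 hx (Finset.mem_filter.1 hp).2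
                  (Finset.mem_filter.1 hp').2 hface
                exact Prod.ext h.1 (DFunLike.coe_injective h.2)

lemma exists_le_lintegral_faceCount {d : ℕ} (hd : 0 < d) {β : Fin d → ℝ} (hβ : ∀ i, 0 ≤ β i) :
    ∃ c > 0, ∀ n : ℕ, 2 * d ≤ n → ENNReal.ofReal (c * Real.log n ^ (d - 1)) ≤
      ∫⁻ x : Fin n → Fin d → ℝ, (faceCount (convexHull ℝ (Set.range x)) (d - 1) : ℝ≥0∞)
        ∂(Measure.pi fun _ : Fin n => Measure.pi fun i => betaMeasure1 (β i)) := by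
  obtain ⟨A, hA, B, hB, hAB⟩ := exists_le_measure_cornerTupleEvent hd hβ
  obtain ⟨M, hM, hM0⟩ : ∃ M : ℕ, (∀ i, halvingRatio (β i) ^ M < 1 / 3) ∧ 0 < M := by
    have h : ∀ᶠ M in atTop, ∀ i, halvingRatio (β i) ^ M < 1 / 3 := eventually_all.2 fun i =>
      (tendsto_pow_atTop_nhds_zero_of_lt_one (halvingRatio_pos (β i)).le
        (halvingRatio_lt_one (hβ i))).eventually_lt_const (by norm_num)
    exact (h.and (eventually_gt_atTop 0)).exists
  obtain ⟨R, hR⟩ := pow_unbounded_of_one_lt (2 * B) one_lt_two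
  have hd' : (0 : ℝ) < d := by exact_mod_cast hd
  have hM' : (0 : ℝ) < M := by exact_mod_cast hM0
  set Q : ℝ := 2 ^ (M * (R + 1)) with hQ
  refine ⟨A * (1 / (2 * Q)) ^ d * (1 / (M * d)) ^ (d - 1), by positivity, fun n hn => ?_⟩
  have hn0 : n ≠ 0 := by omega
  have hn' : (0 : ℝ) < n := by positivity
  have hlog : 0 ≤ Real.log n := Real.log_nonneg (by exact_mod_cast (by omega : 1 ≤ n))
  set N := Nat.log 2 n with hN
  have hlow : (2 : ℝ) ^ N ≤ n := by exact_mod_cast Nat.pow_log_le_self 2 hn0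
  have hup : (n : ℝ) ≤ 2 ^ (N + 1) := by exact_mod_cast (Nat.lt_pow_succ_log_self one_lt_two n).le
  set L := N / M + 1 + R with hL
  have hML1 : N + 1 + R ≤ M * L := by
    have h1 : N < M * (N / M + 1) := Nat.lt_mul_div_succ N hM0
    have h2 : R ≤ M * R := Nat.le_mul_of_pos_left R hM0
    rw [hL, Nat.mul_add]
    omega
  have hML2 : M * L ≤ N + M * (R + 1) := by
    have h1 : M * (N / M) ≤ N := Nat.mul_div_le N M
    rw [hL, show N / M + 1 + R = N / M + (R + 1) by ring, Nat.mul_add]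
    omega
  have hlarge : 2 * B * n ≤ 2 ^ (M * L) := by
    calc 2 * B * n ≤ 2 ^ R * 2 ^ (N + 1) := by gcongr
      _ = 2 ^ (N + 1 + R) := by rw [← pow_add, Nat.add_comm]
      _ ≤ 2 ^ (M * L) := pow_le_pow_right₀ one_le_two hML1
  have hsmall : 1 / (n * Q) ≤ (1 / 2) ^ (M * L) := by
    rw [one_div_pow]
    refine one_div_le_one_div_of_le (by positivity) ?_
    calc (2 : ℝ) ^ (M * L) ≤ 2 ^ (N + M * (R + 1)) := pow_le_pow_right₀ one_le_two hML2
      _ = 2 ^ N * Q := pow_add _ _ _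
      _ ≤ n * Q := by gcongr
  have hlogL : Real.log n / M ≤ L := by
    rw [div_le_iff₀ hM']
    have h1 := Real.log_le_log hn' hup
    rw [Real.log_pow] at h1
    have h2 : ((N + 1 : ℕ) : ℝ) ≤ M * L := by exact_mod_cast (by omega : N + 1 ≤ M * L)
    have h3 : Real.log 2 < 1 := by linarith [Real.log_two_lt_d9]
    nlinarith [Nat.cast_nonneg (α := ℝ) (N + 1)]
  obtain ⟨S, hSsum, hScard⟩ := exists_finset_sum_eq hd L
  calc _ ≤ ENNReal.ofReal (S.card * (Fintype.card (Fin d ↪ Fin n) *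
        (A * ((1 / 2) ^ (M * L)) ^ d))) := by
        refine ENNReal.ofReal_le_ofReal ?_
        calc _ = (Real.log n / M / d) ^ (d - 1) * ((n / 2) ^ d * (A * (1 / (n * Q)) ^ d)) := by
              have h1 : (1 : ℝ) / (2 * Q) = n / 2 * (1 / (n * Q)) := by field_simp
              have h2 : Real.log n / M / d = 1 / (M * d) * Real.log n := by field_simp
              rw [h1, h2, mul_pow, mul_pow]
              ring
          _ ≤ _ := by
              gcongr
              · exact le_trans (by gcongr) hScard
              · exact half_pow_le_card_embedding hn
    _ = ∑ k ∈ S, ∑ _τ : Fin d ↪ Fin n, ENNReal.ofReal (A * ((1 / 2) ^ (M * L)) ^ d) := by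
        rw [Finset.sum_const, Finset.sum_const, Finset.card_univ, nsmul_eq_mul, nsmul_eq_mul,
          ENNReal.ofReal_mul (by positivity), ENNReal.ofReal_mul (by positivity),
          ENNReal.ofReal_natCast, ENNReal.ofReal_natCast]
    _ ≤ ∑ k ∈ S, ∑ τ : Fin d ↪ Fin n,
        (Measure.pi fun _ : Fin n => Measure.pi fun i => betaMeasure1 (β i))
          (cornerTupleEvent (fun i => (halvingRatio (β i) ^ M) ^ k i) τ) := by
        refine Finset.sum_le_sum fun k hk => Finset.sum_le_sum fun τ _ => ?_
        have hsum : ∑ i, M * k i = M * L := by rw [← Finset.mul_sum, hSsum k hk]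
        have h := hAB (fun i => M * k i) n (by omega) (by rw [hsum]; exact hlarge) τ
        rw [hsum] at h
        simpa only [pow_mul] using h
    _ ≤ _ := sum_measure_cornerTupleEvent_le hd hβ (fun i => pow_pos (halvingRatio_pos _) _) hM S

end LowerBound

lemma expectedFacetsCube_eq_toReal_lintegral {d : ℕ} (hd : 0 < d) (β : Fin d → ℝ) (n : ℕ) :
    expectedFacetsCube d β n =
      (∫⁻ x : Fin n → Fin d → ℝ, (faceCount (convexHull ℝ (Set.range x)) (d - 1) : ENNReal)
        ∂(Measure.pi fun _ : Fin n => Measure.pi fun i => betaMeasure1 (β i))).toReal := by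
  rw [expectedFacetsCube, integral_eq_lintegral_of_nonneg_ae
    (Eventually.of_forall fun x => Nat.cast_nonneg _)
    (measurable_faceCount_convexHull hd n).aestronglyMeasurable]
  simp only [ENNReal.ofReal_natCast]

/-- **The cube case `m = d`**: for any beta parameters `β_1,…,β_d ≥ 0`, the expected
number of facets of the random block-beta polytope in the cube satisfies
`E f_{d−1}(P_n^β) ≍ (ln n)^{d−1}`; in particular the asymptotic order does not depend
on the parameters. -/
theorem expected_facets_cube
    (d : ℕ) (hd : 2 ≤ d) (β : Fin d → ℝ) (hβ : ∀ i, 0 ≤ β i) :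
    ∃ c C : ℝ, 0 < c ∧ c ≤ C ∧
      c ≤ liminf (fun n : ℕ => expectedFacetsCube d β n / Real.log n ^ (d - 1)) atTop ∧
      limsup (fun n : ℕ => expectedFacetsCube d β n / Real.log n ^ (d - 1)) atTop ≤ C := by
  have hd0 : 0 < d := by omega
  obtain ⟨c, hc, hlow⟩ := exists_le_lintegral_faceCount hd0 hβ
  obtain ⟨C, hC, hup⟩ := exists_lintegral_faceCount_le hd0 hβ
  have hbounds : ∀ n : ℕ, 2 * d ≤ n →
      c ≤ expectedFacetsCube d β n / Real.log n ^ (d - 1) ∧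
        expectedFacetsCube d β n / Real.log n ^ (d - 1) ≤ C := by
    intro n hn
    have hlog : 0 < Real.log n ^ (d - 1) :=
      pow_pos (Real.log_pos (by exact_mod_cast (by omega : 1 < n))) _
    rw [le_div_iff₀ hlog, div_le_iff₀ hlog, expectedFacetsCube_eq_toReal_lintegral hd0]
    exact ⟨(ENNReal.ofReal_le_iff_le_toReal ((hup n hn).trans_lt ENNReal.ofReal_lt_top).ne).1
      (hlow n hn), ENNReal.toReal_le_of_le_ofReal (by positivity) (hup n hn)⟩
  have hge : ∀ᶠ n : ℕ in atTop, c ≤ expectedFacetsCube d β n / Real.log n ^ (d - 1) :=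
    (eventually_ge_atTop (2 * d)).mono fun n hn => (hbounds n hn).1
  have hle : ∀ᶠ n : ℕ in atTop, expectedFacetsCube d β n / Real.log n ^ (d - 1) ≤ C :=
    (eventually_ge_atTop (2 * d)).mono fun n hn => (hbounds n hn).2
  have hcC := (hbounds (2 * d) le_rfl).1.trans (hbounds (2 * d) le_rfl).2
  exact ⟨c, C, hc, hcC,
    le_liminf_of_le (isBoundedUnder_of_eventually_le hle).isCoboundedUnder_ge hge,
    limsup_le_of_le (isBoundedUnder_of_eventually_ge hge).isCoboundedUnder_le hle⟩
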